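/- Let v : ℝ → ℝ be a bounded six-times continuously differentiable solution of the sixth-order Emden–Fowler ODE with odd nonlinearity, −v⁽⁶⁾ + K₄v⁽⁴⁾ − K₂v″ + K₀v = c_n·|v|^(12/(n−6))·v on ℝ. Then exactly one of the following alternatives holds: (a) v ≡ 0, v ≡ ε_* or v ≡ −ε_*; (b) there exists T ∈ ℝ such that v(t) = (cosh(t − T))^((6−n)/2) for all t, or v(t) = −(cosh(t − T))^((6−n)/2) for all t; (c) v is nonconstant and periodic. -/

import Mathlib

noncomputable section

def K4 (n : ℕ) : ℝ := (3*(n:ℝ)^2 - 12*(n:ℝ) + 44)/4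
def K2 (n : ℕ) : ℝ := (3*(n:ℝ)^4 - 24*(n:ℝ)^3 + 72*(n:ℝ)^2 - 96*(n:ℝ) + 304)/16
def K0 (n : ℕ) : ℝ := ((n:ℝ)-6)^2*((n:ℝ)-2)^2*((n:ℝ)+2)^2/64
def cst (n : ℕ) : ℝ := ((n:ℝ)-6)*((n:ℝ)-4)*((n:ℝ)-2)*(n:ℝ)*((n:ℝ)+2)*((n:ℝ)+4)/64

/-- ε_* = (K₀/c_n)^((n−6)/12). -/
def epsStar (n : ℕ) : ℝ := (K0 n / cst n) ^ (((n:ℝ)-6)/12)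

section Helpers

open Filter Topology

/-! ### Elementary monotonicity helpers -/

lemma aux_mono {f f' : ℝ → ℝ} {x y : ℝ} (hxy : x ≤ y) (hd : ∀ t, HasDerivAt f (f' t) t)
    (h : ∀ t, x < t → t < y → 0 ≤ f' t) : f x ≤ f y := by
  have hm : MonotoneOn f (Set.Icc x y) := by
    apply monotoneOn_of_deriv_nonneg (convex_Icc x y)
    · exact fun t _ => (hd t).continuousAt.continuousWithinAt
    · exact fun t _ => (hd t).differentiableAt.differentiableWithinAt
    · intro t ht
      rw [interior_Icc] at ht
      rw [(hd t).deriv]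
      exact h t ht.1 ht.2
  exact hm ⟨le_refl _, hxy⟩ ⟨hxy, le_refl _⟩ hxy

lemma aux_anti {f f' : ℝ → ℝ} {x y : ℝ} (hxy : x ≤ y) (hd : ∀ t, HasDerivAt f (f' t) t)
    (h : ∀ t, x < t → t < y → f' t ≤ 0) : f y ≤ f x := by
  have := aux_mono (f := fun t => -f t) (f' := fun t => -f' t) hxy (fun t => (hd t).neg)
    (fun t h1 h2 => by have := h t h1 h2; linarith)
  linarith

lemma aux_smono {f f' : ℝ → ℝ} {x y : ℝ} (hxy : x < y) (hd : ∀ t, HasDerivAt f (f' t) t)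
    (h : ∀ t, x < t → t < y → 0 < f' t) : f x < f y := by
  have hm : StrictMonoOn f (Set.Icc x y) := by
    apply strictMonoOn_of_deriv_pos (convex_Icc x y)
    · exact fun t _ => (hd t).continuousAt.continuousWithinAt
    · intro t ht
      rw [interior_Icc] at ht
      rw [(hd t).deriv]
      exact h t ht.1 ht.2
  exact hm ⟨le_refl _, hxy.le⟩ ⟨hxy.le, le_refl _⟩ hxy

lemma aux_grow {f f' : ℝ → ℝ} {x y k : ℝ} (hxy : x ≤ y) (hd : ∀ t, HasDerivAt f (f' t) t)
    (h : ∀ t, x < t → t < y → k ≤ f' t) : f x + k * (y - x) ≤ f y := by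
  have := aux_mono (f := fun t => f t - k * t) (f' := fun t => f' t - k) hxy
    (fun t => ((hd t).sub ((hasDerivAt_id t).const_mul k)).congr_deriv (by simp))
    (fun t h1 h2 => by have := h t h1 h2; linarith)
  linarith

/-- First crossing. -/
lemma aux_first {f f' : ℝ → ℝ} {x y : ℝ} (hd : ∀ t, HasDerivAt f (f' t) t)
    (hx : 0 ≤ f x) :
    (∀ t, x ≤ t → t ≤ y → 0 ≤ f t) ∨
      ∃ s, x ≤ s ∧ s ≤ y ∧ (∀ t, x ≤ t → t ≤ s → 0 ≤ f t) ∧ f s = 0 ∧ f' s ≤ 0 := by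
  by_cases hall : ∀ t, x ≤ t → t ≤ y → 0 ≤ f t
  · exact Or.inl hall
  right
  push Not at hall
  obtain ⟨t0, h1, h2, h3⟩ := hall
  set S : Set ℝ := {t | x ≤ t ∧ t ≤ y ∧ f t < 0} with hS
  have hne : S.Nonempty := ⟨t0, h1, h2, h3⟩
  have hbd : BddBelow S := ⟨x, fun t ht => ht.1⟩
  have hc : Continuous f := continuous_iff_continuousAt.2 fun t => (hd t).continuousAt
  set s := sInf S with hs
  have hxs : x ≤ s := le_csInf hne fun t ht => ht.1
  have hst0 : s ≤ t0 := csInf_le hbd ⟨h1, h2, h3⟩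
  have hlt : ∀ t, x ≤ t → t < s → 0 ≤ f t := by
    intro t ht hts
    by_contra hcon
    push Not at hcon
    have : s ≤ t := csInf_le hbd ⟨ht, by linarith, hcon⟩
    linarith
  have hs0 : 0 ≤ f s := by
    rcases hxs.eq_or_lt with h | h
    · rw [← h]; exact hx
    · by_contra hcon
      push Not at hcon
      have hev : ∀ᶠ t in nhds s, f t < 0 := hc.continuousAt.eventually_lt continuousAt_const hcon
      have hev2 : ∀ᶠ t in nhdsWithin s (Set.Iio s), f t < 0 := hev.filter_mono nhdsWithin_le_nhds
      have hev3 : ∀ᶠ t in nhdsWithin s (Set.Iio s), x < t :=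
        (eventually_gt_nhds h).filter_mono nhdsWithin_le_nhds
      have hev4 : ∀ᶠ t in nhdsWithin s (Set.Iio s), t < s := eventually_mem_nhdsWithin
      obtain ⟨t, ha, hb, hcc⟩ := (hev2.and (hev3.and hev4)).exists
      have := hlt t hb.le hcc
      linarith
  -- there are points of S arbitrarily near
  have hfs : f s = 0 := by
    apply le_antisymm _ hs0
    by_contra hcon
    push Not at hcon
    have hev : ∀ᶠ t in nhds s, 0 < f t := continuousAt_const.eventually_lt hc.continuousAt hcon
    obtain ⟨e, he, hball⟩ := Metric.eventually_nhds_iff.1 hev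
    obtain ⟨t, htS, hts⟩ := exists_lt_of_csInf_lt hne (show sInf S < s + e by linarith)
    have hst : s ≤ t := csInf_le hbd htS
    have := hball (show dist t s < e by rw [Real.dist_eq, abs_of_nonneg (by linarith)]; linarith)
    linarith [htS.2.2]
  refine ⟨s, hxs, by linarith, ?_, hfs, ?_⟩
  · intro t ht hts
    rcases hts.eq_or_lt with h | h
    · rw [h, hfs]
    · exact hlt t ht h
  · by_contra hcon
    push Not at hcon
    have hsl := (hasDerivAt_iff_tendsto_slope.1 (hd s))
    have hev : ∀ᶠ t in nhdsWithin s {s}ᶜ, 0 < slope f s t := hsl.eventually (lt_mem_nhds hcon)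
    rw [eventually_nhdsWithin_iff] at hev
    obtain ⟨e, he, hball⟩ := Metric.eventually_nhds_iff.1 hev
    obtain ⟨t, htS, hts⟩ := exists_lt_of_csInf_lt hne (show sInf S < s + e by linarith)
    have hst : s ≤ t := csInf_le hbd htS
    have hne' : t ≠ s := by
      rintro rfl
      linarith [htS.2.2]
    have := hball (show dist t s < e by rw [Real.dist_eq, abs_of_nonneg (by linarith)]; linarith)
      hne'
    rw [slope_def_field, hfs] at this
    have h5 : 0 < t - s := by
      rcases hst.eq_or_lt with h | h
      · exact absurd h.symm hne'
      · linarith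
    have := (div_pos_iff_of_pos_right h5).1 this
    linarith [htS.2.2]

/-! ### Second order equations f'' = l² f + h -/

lemma aux_hd1 {f p h : ℝ → ℝ} {l : ℝ} (hf : ∀ t, HasDerivAt f (p t) t)
    (hp : ∀ t, HasDerivAt p (l ^ 2 * f t + h t) t) (t : ℝ) :
    HasDerivAt (fun t => Real.exp (-(l * t)) * (p t + l * f t)) (Real.exp (-(l * t)) * h t) t := by
  have he : HasDerivAt (fun t : ℝ => Real.exp (-(l * t))) (Real.exp (-(l * t)) * (-l)) t := by
    have := ((hasDerivAt_id t).const_mul l).neg.exp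
    simpa using this
  have := he.mul ((hp t).add ((hf t).const_mul l))
  refine this.congr_deriv ?_
  simp only [Pi.add_apply]
  ring

lemma aux_hd2 {f p : ℝ → ℝ} {l : ℝ} (hf : ∀ t, HasDerivAt f (p t) t) (t : ℝ) :
    HasDerivAt (fun t => Real.exp (l * t) * f t) (Real.exp (l * t) * (p t + l * f t)) t := by
  have he : HasDerivAt (fun t : ℝ => Real.exp (l * t)) (Real.exp (l * t) * l) t := by
    have := ((hasDerivAt_id t).const_mul l).exp
    simpa using this
  refine (he.mul (hf t)).congr_deriv ?_
  ring

lemma aux_pos {f p h : ℝ → ℝ} {l x y : ℝ} (hl : 0 ≤ l) (hxy : x ≤ y)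
    (hf : ∀ t, HasDerivAt f (p t) t)
    (hp : ∀ t, HasDerivAt p (l ^ 2 * f t + h t) t) (hh : ∀ t, x < t → t < y → 0 ≤ h t)
    (hfx : 0 ≤ f x) (hpx : 0 ≤ p x) : 0 ≤ f y ∧ 0 ≤ p y := by
  have key : ∀ s, x ≤ s → s ≤ y → 0 ≤ p s + l * f s := by
    intro s h1 h2
    have := aux_mono h1 (aux_hd1 hf hp)
      (fun t ht1 ht2 => mul_nonneg (Real.exp_pos _).le (hh t ht1 (by linarith)))
    have h3 : 0 ≤ Real.exp (-(l * x)) * (p x + l * f x) := by positivity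
    have h4 : 0 ≤ Real.exp (-(l * s)) * (p s + l * f s) := h3.trans this
    exact nonneg_of_mul_nonneg_right h4 (Real.exp_pos _)
  have key2 : ∀ s, x ≤ s → s ≤ y → 0 ≤ f s := by
    intro s h1 h2
    have := aux_mono h1 (aux_hd2 (l := l) hf)
      (fun t ht1 ht2 => mul_nonneg (Real.exp_pos _).le (key t ht1.le (by linarith)))
    have h3 : 0 ≤ Real.exp ((l * x)) * (f x) := by positivity
    exact nonneg_of_mul_nonneg_right (h3.trans this) (Real.exp_pos _)
  refine ⟨key2 y hxy le_rfl, ?_⟩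
  have := aux_mono hxy hp (fun t h1 h2 => by
    have := key2 t h1.le h2.le
    have := hh t h1 h2
    positivity)
  linarith

lemma aux_spos {f p h : ℝ → ℝ} {l x y : ℝ} (hl : 0 ≤ l) (hxy : x < y)
    (hf : ∀ t, HasDerivAt f (p t) t)
    (hp : ∀ t, HasDerivAt p (l ^ 2 * f t + h t) t) (hh : ∀ t, x < t → t < y → 0 < h t)
    (hfx : 0 ≤ f x) (hpx : 0 ≤ p x) : 0 < f y ∧ 0 < p y := by
  have key : ∀ s, x ≤ s → s ≤ y → 0 ≤ f s ∧ 0 ≤ p s := fun s h1 h2 =>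
    aux_pos hl h1 hf hp (fun t a b => (hh t a (by linarith)).le) hfx hpx
  have key2 : ∀ s, x < s → s ≤ y → 0 < p s := by
    intro s h1 h2
    have := aux_smono h1 hp (fun t a b => by
      have := (key t a.le (by linarith)).1
      have := hh t a (by linarith)
      positivity)
    linarith
  refine ⟨?_, key2 y hxy le_rfl⟩
  have := aux_smono hxy hf (fun t a b => key2 t a b.le)
  linarith

lemma aux_neg {f p h : ℝ → ℝ} {l x y : ℝ} (hl : 0 ≤ l) (hxy : x ≤ y)
    (hf : ∀ t, HasDerivAt f (p t) t)
    (hp : ∀ t, HasDerivAt p (l ^ 2 * f t + h t) t) (hh : ∀ t, x < t → t < y → h t ≤ 0)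
    (hfx : f x ≤ 0) (hpx : p x ≤ 0) : f y ≤ 0 ∧ p y ≤ 0 := by
  have := aux_pos (f := fun t => -f t) (p := fun t => -p t) (h := fun t => -h t) hl hxy
    (fun t => (hf t).neg) (fun t => (hp t).neg.congr_deriv (by ring))
    (fun t a b => by have := hh t a b; linarith) (by linarith) (by linarith)
  constructor <;> linarith [this.1, this.2]

lemma aux_unbdd {f p d : ℝ → ℝ} {x k M : ℝ} (hf : ∀ t, HasDerivAt f (p t) t)
    (hp : ∀ t, HasDerivAt p (d t) t) (hk : 0 < k) (hd : ∀ t, x ≤ t → k ≤ d t) (hpx : 0 ≤ p x)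
    (hM : ∀ t, |f t| ≤ M) : False := by
  have h1 : ∀ t, x + 1 ≤ t → k ≤ p t := by
    intro t ht
    have := aux_grow (by linarith : x ≤ t) hp (fun s a b => hd s a.le)
    nlinarith
  have h2 : ∀ t, x + 1 ≤ t → f (x+1) + k * (t - (x+1)) ≤ f t := fun t ht =>
    aux_grow ht hf (fun s a b => h1 s a.le)
  have hM0 : 0 ≤ M := (abs_nonneg _).trans (hM 0)
  have h3 := h2 (x + 1 + (2 * M + 1) / k) (by have : 0 ≤ (2 * M + 1) / k := by positivity
                                              linarith)
  have h4 : k * (x + 1 + (2 * M + 1) / k - (x + 1)) = 2 * M + 1 := by field_simp; ring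
  rw [h4] at h3
  have h5 := (abs_le.1 (hM (x+1))).1
  have h6 := (abs_le.1 (hM (x + 1 + (2 * M + 1) / k))).2
  linarith

/-! ### The sixth order system -/

structure Sys6 (a b c : ℝ) (w p u q z r g : ℝ → ℝ) : Prop where
  hw : ∀ t, HasDerivAt w (p t) t
  hp : ∀ t, HasDerivAt p (a ^ 2 * w t + u t) t
  hu : ∀ t, HasDerivAt u (q t) t
  hq : ∀ t, HasDerivAt q (b ^ 2 * u t + z t) t
  hz : ∀ t, HasDerivAt z (r t) t
  hr : ∀ t, HasDerivAt r (c ^ 2 * z t + -g t) t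

structure Bd6 (M : ℝ) (w p u q z r : ℝ → ℝ) : Prop where
  hw : ∀ t, |w t| ≤ M
  hp : ∀ t, |p t| ≤ M
  hu : ∀ t, |u t| ≤ M
  hq : ∀ t, |q t| ≤ M
  hz : ∀ t, |z t| ≤ M
  hr : ∀ t, |r t| ≤ M

lemma Sys6.neg {a b c : ℝ} {w p u q z r g : ℝ → ℝ} (h : Sys6 a b c w p u q z r g) :
    Sys6 a b c (fun t => -w t) (fun t => -p t) (fun t => -u t) (fun t => -q t) (fun t => -z t)
      (fun t => -r t) (fun t => -g t) where
  hw t := (h.hw t).neg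
  hp t := (h.hp t).neg.congr_deriv (by ring)
  hu t := (h.hu t).neg
  hq t := (h.hq t).neg.congr_deriv (by ring)
  hz t := (h.hz t).neg
  hr t := (h.hr t).neg.congr_deriv (by ring)

lemma Bd6.neg {M : ℝ} {w p u q z r : ℝ → ℝ} (h : Bd6 M w p u q z r) :
    Bd6 M (fun t => -w t) (fun t => -p t) (fun t => -u t) (fun t => -q t) (fun t => -z t)
      (fun t => -r t) where
  hw t := by simpa using h.hw t
  hp t := by simpa using h.hp t
  hu t := by simpa using h.hu t
  hq t := by simpa using h.hq t
  hz t := by simpa using h.hz t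
  hr t := by simpa using h.hr t

/-- One half-oscillation inside the cone. -/
lemma step6 {a b c : ℝ} {w p u q z r g : ℝ → ℝ} (ha : 0 < a) (hb : 0 < b) (hc : 0 < c)
    (h : Sys6 a b c w p u q z r g) (hg : ∀ t, 0 ≤ w t → 0 ≤ g t) {t1 t2 : ℝ} (h12 : t1 < t2)
    (hpos : ∀ t, t1 < t → t < t2 → 0 < w t) (hw2 : w t2 = 0)
    (w1 : 0 ≤ w t1) (p1 : 0 ≤ p t1) (u1 : 0 ≤ u t1) (q1 : 0 ≤ q t1)
    (zr : (0 ≤ z t1 ∧ 0 ≤ r t1) ∨ (z t1 ≤ 0 ∧ r t1 ≤ 0)) :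
    (p t2 < 0 ∧ u t2 ≤ 0 ∧ q t2 ≤ 0 ∧ z t2 ≤ 0 ∧ r t2 ≤ 0) ∧
    ∃ tm, t1 ≤ tm ∧ tm < t2 ∧ p tm = 0 ∧ a ^ 2 * w tm + u tm ≤ 0 ∧
      (∀ t, t1 ≤ t → t ≤ tm → 0 ≤ p t ∧ u tm ≤ u t) ∧
      (∀ t, tm ≤ t → t ≤ t2 → p t ≤ 0 ∧ u t ≤ u tm) := by
  have hwnn : ∀ t, t1 ≤ t → t ≤ t2 → 0 ≤ w t := by
    intro t h1 h2
    rcases h1.eq_or_lt with e | e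
    · rw [← e]; exact w1
    rcases h2.eq_or_lt with e' | e'
    · rw [e', hw2]
    exact (hpos t e e').le
  -- w cannot be monotone on the whole interval
  have nomono : ¬ (∀ t, t1 ≤ t → t ≤ t2 → 0 ≤ p t) := by
    intro hp'
    have h1 := hpos ((t1 + t2) / 2) (by linarith) (by linarith)
    have h2 := aux_mono (x := (t1 + t2) / 2) (y := t2) (by linarith) h.hw
      (fun t a b => hp' t (by linarith) b.le)
    linarith
  have nou : ¬ (∀ t, t1 ≤ t → t ≤ t2 → 0 ≤ u t) := by
    intro hu'
    exact nomono fun t a1 a2 => (aux_pos ha.le a1 h.hw h.hp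
      (fun s b1 b2 => hu' s b1.le (by linarith)) w1 p1).2
  -- pattern of z
  have hs2 : ∃ s2, t1 ≤ s2 ∧ s2 ≤ t2 ∧ (∀ t, t1 ≤ t → t < s2 → 0 ≤ z t) ∧ z s2 ≤ 0 ∧ r s2 ≤ 0 := by
    rcases zr with zr | zr
    · rcases aux_first (y := t2) h.hz zr.1 with h1 | ⟨s, h1, h2, h3, h4, h5⟩
      · exfalso
        exact nou fun t a1 a2 => (aux_pos hb.le a1 h.hu h.hq
          (fun s b1 b2 => h1 s b1.le (by linarith)) u1 q1).1
      · exact ⟨s, h1, h2, fun t a b => h3 t a b.le, h4.le, h5⟩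
    · exact ⟨t1, le_rfl, h12.le, fun t a b => by linarith, zr.1, zr.2⟩
  obtain ⟨s2, hs21, hs22, hz1, hz2, hr2⟩ := hs2
  have hzneg : ∀ t, s2 ≤ t → t ≤ t2 → z t ≤ 0 ∧ r t ≤ 0 := fun t a1 a2 =>
    aux_neg hc.le a1 h.hz h.hr
      (fun s b1 b2 => by have := hg s (hwnn s (by linarith) (by linarith)); linarith) hz2 hr2
  have hu1 : ∀ t, t1 ≤ t → t ≤ s2 → 0 ≤ u t ∧ 0 ≤ q t := fun t a1 a2 =>
    aux_pos hb.le a1 h.hu h.hq (fun s b1 b2 => hz1 s b1.le (by linarith)) u1 q1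
  obtain ⟨s1, hs11, hs12, hu2, hu3, hq3⟩ : ∃ s, s2 ≤ s ∧ s ≤ t2 ∧
      (∀ t, s2 ≤ t → t ≤ s → 0 ≤ u t) ∧ u s = 0 ∧ q s ≤ 0 := by
    rcases aux_first (y := t2) h.hu (hu1 s2 hs21 le_rfl).1 with h1 | h1
    · exfalso
      apply nou
      intro t a1 a2
      rcases le_total t s2 with e | e
      · exact (hu1 t a1 e).1
      · exact h1 t e a2
    · exact h1
  have hunn : ∀ t, t1 ≤ t → t ≤ s1 → 0 ≤ u t := by
    intro t a1 a2
    rcases le_total t s2 with e | e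
    · exact (hu1 t a1 e).1
    · exact hu2 t e a2
  have huneg : ∀ t, s1 ≤ t → t ≤ t2 → u t ≤ 0 ∧ q t ≤ 0 := fun t a1 a2 =>
    aux_neg hb.le a1 h.hu h.hq
      (fun s b1 b2 => (hzneg s (by linarith) (by linarith)).1) hu3.le hq3
  have hp1 : ∀ t, t1 ≤ t → t ≤ s1 → 0 ≤ p t := fun t a1 a2 =>
    (aux_pos ha.le a1 h.hw h.hp (fun s b1 b2 => hunn s b1.le (by linarith)) w1 p1).2
  obtain ⟨tm, hm1, hm2, hp2, hp3, hD⟩ : ∃ s, s1 ≤ s ∧ s ≤ t2 ∧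
      (∀ t, s1 ≤ t → t ≤ s → 0 ≤ p t) ∧ p s = 0 ∧ a ^ 2 * w s + u s ≤ 0 := by
    rcases aux_first (y := t2) h.hp (hp1 s1 (by linarith) le_rfl) with h1 | h1
    · exfalso
      apply nomono
      intro t a1 a2
      rcases le_total t s1 with e | e
      · exact hp1 t a1 e
      · exact h1 t e a2
    · exact h1
  have hDd : ∀ t, HasDerivAt (fun t => a ^ 2 * w t + u t) (a ^ 2 * p t + q t) t := fun t =>
    ((h.hw t).const_mul _).add (h.hu t)
  have hpneg : ∀ t, tm ≤ t → t ≤ t2 → p t ≤ 0 ∧ a ^ 2 * w t + u t ≤ 0 := fun t a1 a2 =>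
    aux_neg ha.le a1 h.hp hDd
      (fun s b1 b2 => (huneg s (by linarith) (by linarith)).2) hp3.le hD
  have hppos : ∀ t, t1 ≤ t → t ≤ tm → 0 ≤ p t := by
    intro t a1 a2
    rcases le_total t s1 with e | e
    · exact hp1 t a1 e
    · exact hp2 t e a2
  have huanti : ∀ s t, s1 ≤ s → s ≤ t → t ≤ t2 → u t ≤ u s := fun s t a1 a2 a3 =>
    aux_anti a2 h.hu (fun x b1 b2 => (huneg x (by linarith) (by linarith)).2)
  have hwm : 0 < w tm := by
    have h1 := hpos ((t1 + t2) / 2) (by linarith) (by linarith)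
    rcases le_total ((t1 + t2) / 2) tm with e | e
    · have := aux_mono e h.hw (fun t a b => hppos t (by linarith) b.le)
      linarith
    · have := aux_anti e h.hw (fun t a b => (hpneg t a.le (by linarith)).1)
      linarith
  have hm3 : tm < t2 := by
    rcases hm2.eq_or_lt with e | e
    · rw [e] at hwm; linarith
    · exact e
  have hp4 : p t2 < 0 := by
    by_contra hcon
    push Not at hcon
    have : ∀ t, tm < t → t < t2 → 0 ≤ p t := by
      intro t a1 a2
      have := aux_anti a2.le h.hp (fun x b1 b2 => (hpneg x (by linarith) (by linarith)).2)
      linarith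
    have := aux_mono hm3.le h.hw this
    linarith
  refine ⟨⟨hp4, (huneg t2 (by linarith) le_rfl).1, (huneg t2 (by linarith) le_rfl).2,
    (hzneg t2 (by linarith) le_rfl).1, (hzneg t2 (by linarith) le_rfl).2⟩, tm, by linarith, hm3,
    hp3, hD, ?_, ?_⟩
  · intro t a1 a2
    refine ⟨hppos t a1 a2, ?_⟩
    rcases le_total t s1 with e | e
    · exact (huneg tm hm1 hm2).1.trans (hunn t a1 e)
    · exact huanti t tm e a2 hm2
  · intro t a1 a2
    exact ⟨(hpneg t a1 a2).1, huanti tm t hm1 a1 a2⟩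

/-- A trajectory in the cone that stays positive is unbounded. -/
lemma nozero6 {a b c M : ℝ} {w p u q z r g : ℝ → ℝ} (ha : 0 < a) (hb : 0 < b) (hc : 0 < c)
    (h : Sys6 a b c w p u q z r g) (hbd : Bd6 M w p u q z r)
    (hg : ∀ t, 0 ≤ w t → 0 ≤ g t) {t1 : ℝ}
    (hpos : ∀ t, t1 < t → 0 < w t)
    (w1 : 0 ≤ w t1) (p1 : 0 ≤ p t1) (u1 : 0 ≤ u t1) (q1 : 0 ≤ q t1)
    (zr : (0 ≤ z t1 ∧ 0 ≤ r t1) ∨ (z t1 ≤ 0 ∧ r t1 ≤ 0)) : False := by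
  by_cases hz : ∀ t, t1 ≤ t → 0 ≤ z t
  · have hu : ∀ t, t1 ≤ t → 0 ≤ u t := fun t a1 => (aux_pos hb.le a1 h.hu h.hq
      (fun s b1 b2 => hz s b1.le) u1 q1).1
    have hp : ∀ t, t1 ≤ t → 0 ≤ p t := fun t a1 => (aux_pos ha.le a1 h.hw h.hp
      (fun s b1 b2 => hu s b1.le) w1 p1).2
    have hw0 := hpos (t1 + 1) (by linarith)
    refine aux_unbdd (x := t1 + 1) (k := a ^ 2 * w (t1 + 1)) h.hw h.hp (by positivity) ?_
      (hp _ (by linarith)) hbd.hw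
    intro t ht
    have h1 := aux_mono ht h.hw (fun s b1 b2 => hp s (by linarith))
    have h2 := hu t (by linarith)
    have h3 : a ^ 2 * w (t1 + 1) ≤ a ^ 2 * w t := by gcongr
    linarith
  · push Not at hz
    obtain ⟨y, hy1, hy2⟩ := hz
    obtain ⟨s, hs1, hs2, hs3, hs4⟩ : ∃ s, t1 ≤ s ∧ s ≤ y ∧ z s ≤ 0 ∧ r s ≤ 0 := by
      rcases zr with zr | zr
      · rcases aux_first (y := y) h.hz zr.1 with h1 | ⟨s, h1, h2, h3, h4, h5⟩
        · have := h1 y hy1 le_rfl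
          linarith
        · exact ⟨s, h1, h2, h4.le, h5⟩
      · exact ⟨t1, le_rfl, hy1, zr.1, zr.2⟩
    have hzn : ∀ t, s ≤ t → z t ≤ 0 ∧ r t ≤ 0 := fun t a1 => aux_neg hc.le a1 h.hz h.hr
      (fun x b1 b2 => by have := hg x (hpos x (by linarith)).le; linarith) hs3 hs4
    refine aux_unbdd (x := y + 1) (k := - (c ^ 2 * z y)) (f := fun t => - z t) (p := fun t => -r t)
      (fun t => (h.hz t).neg) (fun t => (h.hr t).neg) (by
        have : 0 < c ^ 2 := by positivity
        nlinarith) ?_ (by have := (hzn (y+1) (by linarith)).2; linarith)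
      (fun t => by simpa using hbd.hz t)
    intro t ht
    have h1 := aux_anti (by linarith : y ≤ t) h.hz (fun x b1 b2 => (hzn x (by linarith)).2)
    have h2 := hg t (hpos t (by linarith)).le
    have h3 : c ^ 2 * z t ≤ c ^ 2 * z y := by gcongr
    linarith

/-- Uniform energy gain during one half oscillation. -/
lemma gain6 {a b c M m : ℝ} (ha : 0 < a) (hb : 0 < b) (hc : 0 < c) (hm : 0 < m) (hM : 0 < M) :
    ∃ γ > 0, ∀ w p u q z r g : ℝ → ℝ, Sys6 a b c w p u q z r g → Bd6 M w p u q z r →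
      (∀ t, 0 ≤ w t → 0 ≤ g t) → ∀ t1 t2 : ℝ, t1 < t2 → (∀ t, t1 < t → t < t2 → 0 < w t) →
      w t2 = 0 → w t1 = 0 → m ≤ p t1 → 0 ≤ u t1 → 0 ≤ q t1 → 
      ((0 ≤ z t1 ∧ 0 ≤ r t1) ∨ (z t1 ≤ 0 ∧ r t1 ≤ 0)) → (p t1) ^ 2 + γ ≤ (p t2) ^ 2 := by
  set M' := a ^ 2 * M + M with hM'
  have hM'0 : 0 < M' := by positivity
  set δ := m / (2 * M') with hδ
  have hδ0 : 0 < δ := by positivity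
  set κ := a ^ 2 * (m * δ / 2) with hκ
  have hκ0 : 0 < κ := by positivity
  set δ' := min δ (κ / (2 * M)) with hδ'
  have hδ'0 : 0 < δ' := by positivity
  refine ⟨m * κ / 2 * δ', by positivity, ?_⟩
  intro w p u q z r g h hbd hg t1 t2 h12 hpos hw2 hw1 hp1 hu1 hq1 zr
  obtain ⟨⟨hp2, -⟩, tm, hm1, hm2, hm3, hm4, hm5, hm6⟩ := step6 ha hb hc h hg h12 hpos hw2 hw1.ge
    (by linarith) hu1 hq1 zr
  have hpd : ∀ t, -M' ≤ a ^ 2 * w t + u t := by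
    intro t
    have h1 := (abs_le.1 (hbd.hw t)).1
    have h2 := (abs_le.1 (hbd.hu t)).1
    have : a ^ 2 * (-M) ≤ a ^ 2 * w t := by gcongr
    linarith
  have hplow : ∀ t, t1 ≤ t → t ≤ t1 + δ → m / 2 ≤ p t := by
    intro t a1 a2
    have h1 := aux_grow a1 h.hp (fun s _ _ => hpd s)
    have h2 : M' * (t - t1) ≤ M' * δ := by gcongr; linarith
    have h3 : M' * δ = m / 2 := by rw [hδ]; field_simp
    linarith
  have hδm : t1 + δ ≤ tm := by
    by_contra hcon
    push Not at hcon
    have := hplow tm hm1 hcon.le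
    linarith
  have hwm : m * δ / 2 ≤ w tm := by
    have h1 := aux_grow (by linarith : t1 ≤ t1 + δ) h.hw
      (fun s a1 a2 => hplow s a1.le a2.le)
    have h2 := aux_mono hδm h.hw (fun s a1 a2 => (hm5 s (by linarith) a2.le).1)
    nlinarith
  have hκm : κ ≤ - u tm := by
    have : κ ≤ a ^ 2 * w tm := by rw [hκ]; gcongr
    linarith
  -- the monotone quantity
  have hE : ∀ t, HasDerivAt (fun t => (p t) ^ 2 - a ^ 2 * (w t) ^ 2 + 2 * (-u tm) * w t)
      (2 * p t * (u t - u tm)) t := by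
    intro t
    have := (((h.hp t).pow 2).sub (((h.hw t).pow 2).const_mul (a ^ 2))).add
      ((h.hw t).const_mul (2 * (-u tm)))
    refine this.congr_deriv ?_
    push_cast
    ring
  have e1 := aux_grow (x := t1) (y := t1 + δ') (k := m * κ / 2) (by linarith) hE (by
    intro t a1 a2
    have d1 : δ' ≤ δ := min_le_left _ _
    have d2 : δ' ≤ κ / (2 * M) := min_le_right _ _
    have h1 := hplow t a1.le (by linarith)
    have h2 := aux_grow a1.le h.hu (fun s _ _ => (abs_le.1 (hbd.hq s)).1)
    have h3 : M * (t - t1) ≤ M * (κ / (2 * M)) := by gcongr; linarith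
    have h4 : M * (κ / (2 * M)) = κ / 2 := by field_simp
    have h5 : κ / 2 ≤ u t - u tm := by linarith
    have hpp : 0 ≤ 2 * p t := by linarith
    calc m * κ / 2 = 2 * (m / 2) * (κ / 2) := by ring
      _ ≤ 2 * p t * (u t - u tm) := by gcongr)
  have e2 := aux_mono (x := t1 + δ') (y := tm) (by
    have d1 : δ' ≤ δ := min_le_left _ _
    linarith) hE (by
      intro t a1 a2
      have := hm5 t (by linarith) a2.le
      have h1 := this.1
      have h2 : 0 ≤ u t - u tm := by linarith [this.2]
      positivity)
  have e3 := aux_mono (x := tm) (y := t2) hm2.le hE (by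
      intro t a1 a2
      have := hm6 t a1.le a2.le
      have h1 := this.1
      have h2 : u t - u tm ≤ 0 := by linarith [this.2]
      nlinarith)
  simp only [hw1, hw2] at e1 e2 e3
  have : t1 + δ' - t1 = δ' := by ring
  rw [this] at e1
  nlinarith

lemma next6 {a b c M : ℝ} {w p u q z r g : ℝ → ℝ} (ha : 0 < a) (hb : 0 < b) (hc : 0 < c)
    (h : Sys6 a b c w p u q z r g) (hbd : Bd6 M w p u q z r)
    (hg : ∀ t, 0 ≤ w t → 0 ≤ g t) {t1 : ℝ} {δ : ℝ} (hδ : 0 < δ)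
    (hpos : ∀ t, t1 < t → t < t1 + δ → 0 < w t)
    (w1 : 0 ≤ w t1) (p1 : 0 ≤ p t1) (u1 : 0 ≤ u t1) (q1 : 0 ≤ q t1)
    (zr : (0 ≤ z t1 ∧ 0 ≤ r t1) ∨ (z t1 ≤ 0 ∧ r t1 ≤ 0)) :
    ∃ t2, t1 < t2 ∧ (∀ t, t1 < t → t < t2 → 0 < w t) ∧ w t2 = 0 := by
  by_cases hall : ∀ t, t1 < t → 0 < w t
  · exact (nozero6 ha hb hc h hbd hg hall w1 p1 u1 q1 zr).elim
  push Not at hall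
  obtain ⟨y, hy1, hy2⟩ := hall
  set S : Set ℝ := {t | t1 < t ∧ w t ≤ 0} with hS
  have hne : S.Nonempty := ⟨y, hy1, hy2⟩
  have hlb : ∀ t ∈ S, t1 + δ ≤ t := by
    intro t ht
    by_contra hcon
    push Not at hcon
    have := hpos t ht.1 hcon
    linarith [ht.2]
  have hbdS : BddBelow S := ⟨t1 + δ, hlb⟩
  have hcont : Continuous w := continuous_iff_continuousAt.2 fun t => (h.hw t).continuousAt
  have h1 : t1 + δ ≤ sInf S := le_csInf hne hlb
  have hlt : ∀ t, t1 < t → t < sInf S → 0 < w t := by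
    intro t a1 a2
    by_contra hcon
    push Not at hcon
    have := csInf_le hbdS (show t ∈ S from ⟨a1, hcon⟩)
    linarith
  refine ⟨sInf S, by linarith, hlt, ?_⟩
  have hS2 : S = {t | t1 + δ ≤ t ∧ w t ≤ 0} := by
    ext t
    constructor
    · exact fun ht => ⟨hlb t ht, ht.2⟩
    · rintro ⟨h1, h2⟩
      exact ⟨by linarith, h2⟩
  have hclosed : IsClosed S := by
    rw [hS2]
    exact (isClosed_le continuous_const continuous_id).inter (isClosed_le hcont continuous_const)
  have hmem := hclosed.csInf_mem hne hbdS
  apply le_antisymm hmem.2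
  by_contra hcon
  push Not at hcon
  have hev : ∀ᶠ t in nhds (sInf S), w t < 0 :=
    hcont.continuousAt.eventually_lt continuousAt_const hcon
  have hev2 : ∀ᶠ t in nhdsWithin (sInf S) (Set.Iio (sInf S)), w t < 0 :=
    hev.filter_mono nhdsWithin_le_nhds
  have hev3 : ∀ᶠ t in nhdsWithin (sInf S) (Set.Iio (sInf S)), t1 < t :=
    (eventually_gt_nhds (by linarith)).filter_mono nhdsWithin_le_nhds
  have hev4 : ∀ᶠ t in nhdsWithin (sInf S) (Set.Iio (sInf S)), t < sInf S :=
    eventually_mem_nhdsWithin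
  obtain ⟨t, e1, e2, e3⟩ := (hev2.and (hev3.and hev4)).exists
  have := hlt t e2 e3
  linarith

/-- A solution of the cyclic system that starts in the cone is unbounded. -/
lemma grow6 {a b c M : ℝ} {w p u q z r g : ℝ → ℝ} (ha : 0 < a) (hb : 0 < b) (hc : 0 < c)
    (h : Sys6 a b c w p u q z r g) (hbd : Bd6 M w p u q z r)
    (hg : ∀ t, 0 ≤ w t → 0 ≤ g t) (hg' : ∀ t, w t ≤ 0 → g t ≤ 0) {t1 : ℝ} {δ : ℝ} (hδ : 0 < δ)
    (hpos : ∀ t, t1 < t → t < t1 + δ → 0 < w t)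
    (w1 : 0 ≤ w t1) (p1 : 0 ≤ p t1) (u1 : 0 ≤ u t1) (q1 : 0 ≤ q t1)
    (zr : (0 ≤ z t1 ∧ 0 ≤ r t1) ∨ (z t1 ≤ 0 ∧ r t1 ≤ 0)) : False := by
  have hM : 0 < M := by
    have h1 := hpos (t1 + δ / 2) (by linarith) (by linarith)
    have h2 := hbd.hw (t1 + δ / 2)
    exact lt_of_lt_of_le (abs_pos.2 h1.ne') h2
  obtain ⟨t2, h12, hpos2, hw2⟩ := next6 ha hb hc h hbd hg hδ hpos w1 p1 u1 q1 zr
  obtain ⟨⟨e1, e2, e3, e4, e5⟩, -⟩ := step6 ha hb hc h hg h12 hpos2 hw2 w1 p1 u1 q1 zr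
  obtain ⟨γ, hγ, hgain⟩ := gain6 (a := a) (b := b) (c := c) (M := M) (m := - p t2) ha hb hc
    (by linarith) hM
  set m := - p t2 with hm
  have hm0 : 0 < m := by linarith
  have main : ∀ j : ℕ, ∃ w p u q z r g : ℝ → ℝ, Sys6 a b c w p u q z r g ∧ Bd6 M w p u q z r ∧
      (∀ t, 0 ≤ w t → 0 ≤ g t) ∧ (∀ t, w t ≤ 0 → g t ≤ 0) ∧ ∃ t, w t = 0 ∧ m ≤ p t ∧ 0 ≤ u t ∧
      0 ≤ q t ∧ 0 ≤ z t ∧ 0 ≤ r t ∧ m ^ 2 + j * γ ≤ (p t) ^ 2 := by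
    intro j
    induction j with
    | zero =>
      refine ⟨_, _, _, _, _, _, _, h.neg, hbd.neg, fun t ht => ?_, fun t ht => ?_, t2, ?_⟩
      · have := hg' t (by linarith); linarith
      · have := hg t (by linarith); linarith
      · refine ⟨by linarith, by linarith, by linarith, by linarith, by linarith, by linarith, ?_⟩
        simp [hm]
    | succ j ih =>
      obtain ⟨w, p, u, q, z, r, g, h, hbd, hg, hg', t1, i1, i2, i3, i4, i5, i6, i7⟩ := ih
      obtain ⟨δ, hδ, hpos⟩ : ∃ δ > 0, ∀ t, t1 < t → t < t1 + δ → 0 < w t := by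
        have hcp : ContinuousAt p t1 := (h.hp t1).continuousAt
        have hev : ∀ᶠ t in nhds t1, 0 < p t :=
          continuousAt_const.eventually_lt hcp (by linarith)
        obtain ⟨e, he, hball⟩ := Metric.eventually_nhds_iff.1 hev
        refine ⟨e, he, fun t a1 a2 => ?_⟩
        have := aux_smono a1 h.hw (fun s b1 b2 => hball (by
          rw [Real.dist_eq, abs_of_nonneg (by linarith)]; linarith))
        linarith
      obtain ⟨t2, h12, hpos2, hw2⟩ := next6 ha hb hc h hbd hg hδ hpos i1.ge (by linarith) i3 i4
        (Or.inl ⟨i5, i6⟩)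
      obtain ⟨⟨e1, e2, e3, e4, e5⟩, -⟩ := step6 ha hb hc h hg h12 hpos2 hw2 i1.ge (by linarith)
        i3 i4 (Or.inl ⟨i5, i6⟩)
      have hgn := hgain w p u q z r g h hbd hg t1 t2 h12 hpos2 hw2 i1 i2 i3 i4 (Or.inl ⟨i5, i6⟩)
      refine ⟨_, _, _, _, _, _, _, h.neg, hbd.neg, fun t ht => ?_, fun t ht => ?_, t2, ?_⟩
      · have := hg' t (by linarith); linarith
      · have := hg t (by linarith); linarith
      · refine ⟨by linarith, ?_, by linarith, by linarith, by linarith, by linarith, ?_⟩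
        · nlinarith
        · push_cast
          nlinarith
  obtain ⟨j, hj⟩ := exists_nat_gt (M ^ 2 / γ)
  obtain ⟨w, p, u, q, z, r, g, h, hbd, hg, hg', t1, i1, i2, i3, i4, i5, i6, i7⟩ := main j
  have h1 : M ^ 2 < j * γ := by rwa [div_lt_iff₀ hγ] at hj
  have h2 : (p t1) ^ 2 ≤ M ^ 2 := sq_le_sq.2 ((hbd.hp t1).trans (le_abs_self M))
  nlinarith

/-! ### Operations on systems -/

lemma Sys6.sub {a b c : ℝ} {w p u q z r g w' p' u' q' z' r' g' : ℝ → ℝ}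
    (h : Sys6 a b c w p u q z r g) (h' : Sys6 a b c w' p' u' q' z' r' g') :
    Sys6 a b c (fun t => w t - w' t) (fun t => p t - p' t) (fun t => u t - u' t)
      (fun t => q t - q' t) (fun t => z t - z' t) (fun t => r t - r' t) (fun t => g t - g' t) where
  hw t := (h.hw t).sub (h'.hw t)
  hp t := ((h.hp t).sub (h'.hp t)).congr_deriv (by ring)
  hu t := (h.hu t).sub (h'.hu t)
  hq t := ((h.hq t).sub (h'.hq t)).congr_deriv (by ring)
  hz t := (h.hz t).sub (h'.hz t)
  hr t := ((h.hr t).sub (h'.hr t)).congr_deriv (by ring)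

lemma Bd6.sub {M M' : ℝ} {w p u q z r w' p' u' q' z' r' : ℝ → ℝ}
    (h : Bd6 M w p u q z r) (h' : Bd6 M' w' p' u' q' z' r') :
    Bd6 (M + M') (fun t => w t - w' t) (fun t => p t - p' t) (fun t => u t - u' t)
      (fun t => q t - q' t) (fun t => z t - z' t) (fun t => r t - r' t) where
  hw t := (abs_sub _ _).trans (add_le_add (h.hw t) (h'.hw t))
  hp t := (abs_sub _ _).trans (add_le_add (h.hp t) (h'.hp t))
  hu t := (abs_sub _ _).trans (add_le_add (h.hu t) (h'.hu t))
  hq t := (abs_sub _ _).trans (add_le_add (h.hq t) (h'.hq t))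
  hz t := (abs_sub _ _).trans (add_le_add (h.hz t) (h'.hz t))
  hr t := (abs_sub _ _).trans (add_le_add (h.hr t) (h'.hr t))

lemma hasDerivAt_refl_aux {f : ℝ → ℝ} {d s t : ℝ} (h : HasDerivAt f d (s - t)) :
    HasDerivAt (fun x => f (s - x)) (-d) t := by
  have h1 : HasDerivAt (fun x : ℝ => s - x) (-1) t := by
    simpa using (hasDerivAt_id t).const_sub s
  have := HasDerivAt.comp t h h1
  exact this.congr_deriv (by ring)

lemma hasDerivAt_shift_aux {f : ℝ → ℝ} {d s t : ℝ} (h : HasDerivAt f d (t + s)) :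
    HasDerivAt (fun x => f (x + s)) d t := by
  have h1 : HasDerivAt (fun x : ℝ => x + s) 1 t := by
    simpa using (hasDerivAt_id t).add_const s
  have := HasDerivAt.comp t h h1
  exact this.congr_deriv (by ring)

/-- Reflection `t ↦ s - t`. -/
lemma Sys6.refl {a b c : ℝ} {w p u q z r g : ℝ → ℝ} (s : ℝ) (h : Sys6 a b c w p u q z r g) :
    Sys6 a b c (fun t => w (s - t)) (fun t => -p (s - t)) (fun t => u (s - t))
      (fun t => -q (s - t)) (fun t => z (s - t)) (fun t => -r (s - t)) (fun t => g (s - t)) where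
  hw t := hasDerivAt_refl_aux (h.hw _)
  hp t := (hasDerivAt_refl_aux (h.hp (s - t))).neg.congr_deriv (by ring)
  hu t := hasDerivAt_refl_aux (h.hu _)
  hq t := (hasDerivAt_refl_aux (h.hq (s - t))).neg.congr_deriv (by ring)
  hz t := hasDerivAt_refl_aux (h.hz _)
  hr t := (hasDerivAt_refl_aux (h.hr (s - t))).neg.congr_deriv (by ring)

lemma Bd6.refl {M : ℝ} {w p u q z r : ℝ → ℝ} (s : ℝ) (h : Bd6 M w p u q z r) :
    Bd6 M (fun t => w (s - t)) (fun t => -p (s - t)) (fun t => u (s - t))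
      (fun t => -q (s - t)) (fun t => z (s - t)) (fun t => -r (s - t)) where
  hw t := h.hw _
  hp t := by simpa using h.hp (s - t)
  hu t := h.hu _
  hq t := by simpa using h.hq (s - t)
  hz t := h.hz _
  hr t := by simpa using h.hr (s - t)

/-! ### Uniqueness -/

lemma two_mul_le_aux (x y : ℝ) : 2 * |x * y| ≤ x ^ 2 + y ^ 2 := by
  rw [abs_mul]
  nlinarith [sq_nonneg (|x| - |y|), sq_abs x, sq_abs y]

lemma Sys6.energy {a b c K : ℝ} {w p u q z r g : ℝ → ℝ} (h : Sys6 a b c w p u q z r g)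
    (hK : ∀ t, |g t| ≤ K * |w t|) {t0 : ℝ} (h1 : w t0 = 0) (h2 : p t0 = 0)
    (h3 : u t0 = 0) (h4 : q t0 = 0) (h5 : z t0 = 0) (h6 : r t0 = 0) :
    ∀ t, t0 ≤ t → w t = 0 := by
  have hK0 : 0 ≤ |K| := abs_nonneg K
  set C := 4 + 2 * a ^ 2 + 2 * b ^ 2 + 2 * c ^ 2 + |K| with hC
  set E : ℝ → ℝ := fun t => w t ^ 2 + p t ^ 2 + u t ^ 2 + q t ^ 2 + z t ^ 2 + r t ^ 2 with hE
  set E' : ℝ → ℝ := fun t => 2 * (w t * p t) + 2 * (p t * (a ^ 2 * w t + u t)) + 2 * (u t * q t)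
    + 2 * (q t * (b ^ 2 * u t + z t)) + 2 * (z t * r t) + 2 * (r t * (c ^ 2 * z t + - g t)) with hE'
  have hd : ∀ t, HasDerivAt E (E' t) t := by
    intro t
    have := (((((((h.hw t).pow 2).add ((h.hp t).pow 2)).add ((h.hu t).pow 2)).add
      ((h.hq t).pow 2)).add ((h.hz t).pow 2)).add ((h.hr t).pow 2))
    refine this.congr_deriv ?_
    simp only [hE']
    push_cast
    ring
  have hle : ∀ t, E' t ≤ C * E t := by
    intro t
    have m : ∀ x y : ℝ, 2 * (x * y) ≤ x ^ 2 + y ^ 2 := fun x y => by nlinarith [sq_nonneg (x - y)]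
    have i7 : 2 * (r t * (- g t)) ≤ |K| * (r t ^ 2 + w t ^ 2) := by
      have j1 : r t * (- g t) ≤ |r t| * |g t| := by
        rw [← abs_neg (g t), ← abs_mul]; exact le_abs_self _
      have j2 : |r t| * |g t| ≤ |r t| * (|K| * |w t|) := by
        gcongr
        exact (hK t).trans (by gcongr; exact le_abs_self K)
      have j3 : 2 * (|r t| * (|K| * |w t|)) ≤ |K| * (r t ^ 2 + w t ^ 2) := by
        have := m |r t| |w t|
        rw [sq_abs, sq_abs] at this
        calc 2 * (|r t| * (|K| * |w t|)) = |K| * (2 * (|r t| * |w t|)) := by ring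
          _ ≤ _ := by gcongr
      linarith
    have i2 : a ^ 2 * (2 * (p t * w t)) ≤ a ^ 2 * (p t ^ 2 + w t ^ 2) := by gcongr; exact m _ _
    have i3 : b ^ 2 * (2 * (q t * u t)) ≤ b ^ 2 * (q t ^ 2 + u t ^ 2) := by gcongr; exact m _ _
    have i4 : c ^ 2 * (2 * (r t * z t)) ≤ c ^ 2 * (r t ^ 2 + z t ^ 2) := by gcongr; exact m _ _
    have i5 := m (w t) (p t)
    have i6 := m (p t) (u t)
    have i8 := m (u t) (q t)
    have i9 := m (q t) (z t)
    have i10 := m (z t) (r t)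
    simp only [hE', hE, hC]
    have n1 := sq_nonneg (w t)
    have n2 := sq_nonneg (p t)
    have n3 := sq_nonneg (u t)
    have n4 := sq_nonneg (q t)
    have n5 := sq_nonneg (z t)
    have n6 := sq_nonneg (r t)
    have na := sq_nonneg a
    have nb := sq_nonneg b
    have nc := sq_nonneg c
    have P : ∀ {x y : ℝ}, 0 ≤ x → 0 ≤ y → 0 ≤ x * y := fun hx hy => mul_nonneg hx hy
    linarith [P na n1, P na n2, P na n3, P na n4, P na n5, P na n6, P nb n1, P nb n2, P nb n3,
      P nb n4, P nb n5, P nb n6, P nc n1, P nc n2, P nc n3, P nc n4, P nc n5, P nc n6,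
      P hK0 n1, P hK0 n2, P hK0 n3, P hK0 n4, P hK0 n5, P hK0 n6]
  intro t ht
  have hd2 := aux_hd2 (l := -C) hd
  have := aux_anti ht hd2 (fun s _ _ => by
    have := hle s
    have he := (Real.exp_pos (-C * s)).le
    exact mul_nonpos_of_nonneg_of_nonpos he (by linarith))
  have hE0 : E t0 = 0 := by simp [hE, h1, h2, h3, h4, h5, h6]
  rw [hE0, mul_zero] at this
  have h7 : E t ≤ 0 := by
    by_contra hcon
    push Not at hcon
    have := mul_pos (Real.exp_pos (-C * t)) hcon
    linarith
  have h8 : w t ^ 2 ≤ 0 := by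
    simp only [hE] at h7
    nlinarith [sq_nonneg (w t), sq_nonneg (p t), sq_nonneg (u t), sq_nonneg (q t), sq_nonneg (z t), sq_nonneg (r t)]
  nlinarith [sq_nonneg (w t)]

lemma Sys6.unique {a b c K : ℝ} {w p u q z r g : ℝ → ℝ} (h : Sys6 a b c w p u q z r g)
    (hK : ∀ t, |g t| ≤ K * |w t|) {t0 : ℝ} (h1 : w t0 = 0) (h2 : p t0 = 0)
    (h3 : u t0 = 0) (h4 : q t0 = 0) (h5 : z t0 = 0) (h6 : r t0 = 0) :
    ∀ t, w t = 0 := by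
  intro t
  rcases le_total t0 t with ht | ht
  · exact h.energy hK h1 h2 h3 h4 h5 h6 t ht
  · have := (h.refl 0).energy (t0 := -t0) (K := K) (fun t => hK _) (by simpa using h1)
      (by simpa using h2) (by simpa using h3) (by simpa using h4) (by simpa using h5)
      (by simpa using h6) (-t) (by linarith)
    simpa using this

/-! ### Lemma Z -/

lemma posright {f f' : ℝ → ℝ} {t0 : ℝ} (hf : ∀ t, HasDerivAt f (f' t) t)
    (hf' : Continuous f') (h : 0 < f t0 ∨ (f t0 = 0 ∧ 0 < f' t0)) :
    ∃ δ > 0, ∀ t, t0 < t → t < t0 + δ → 0 < f t := by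
  rcases h with h | ⟨h, h'⟩
  · have hev : ∀ᶠ t in nhds t0, 0 < f t :=
      continuousAt_const.eventually_lt (hf t0).continuousAt h
    obtain ⟨e, he, hball⟩ := Metric.eventually_nhds_iff.1 hev
    exact ⟨e, he, fun t a1 a2 => hball (by
          rw [Real.dist_eq, abs_of_nonneg (by linarith)]; linarith)⟩
  · have hev : ∀ᶠ t in nhds t0, 0 < f' t :=
      continuousAt_const.eventually_lt hf'.continuousAt h'
    obtain ⟨e, he, hball⟩ := Metric.eventually_nhds_iff.1 hev
    refine ⟨e, he, fun t a1 a2 => ?_⟩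
    have := aux_smono a1 hf (fun s b1 b2 => hball (by
          rw [Real.dist_eq, abs_of_nonneg (by linarith)]; linarith))
    linarith

lemma cont_of_hd {f f' : ℝ → ℝ} (hf : ∀ t, HasDerivAt f (f' t) t) : Continuous f :=
  continuous_iff_continuousAt.2 fun t => (hf t).continuousAt

/-- starting in the cone with w = p = 0 but non trivial is impossible. -/
lemma coneZ {a b c M : ℝ} {w p u q z r g : ℝ → ℝ} (ha : 0 < a) (hb : 0 < b) (hc : 0 < c)
    (h : Sys6 a b c w p u q z r g) (hbd : Bd6 M w p u q z r)
    (hg : ∀ t, 0 ≤ w t → 0 ≤ g t) (hg' : ∀ t, w t ≤ 0 → g t ≤ 0) {t0 : ℝ}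
    (h1 : w t0 = 0) (h2 : p t0 = 0) (hu : 0 ≤ u t0) (hq : 0 ≤ q t0)
    (zr : (0 ≤ z t0 ∧ 0 ≤ r t0) ∨ (z t0 ≤ 0 ∧ r t0 ≤ 0))
    (hne : 0 < u t0 ∨ (u t0 = 0 ∧ 0 < q t0) ∨ 
      (u t0 = 0 ∧ q t0 = 0 ∧ (0 < z t0 ∨ (z t0 = 0 ∧ 0 < r t0)))) : False := by
  have hupos : ∃ δ > 0, ∀ t, t0 < t → t < t0 + δ → 0 < u t := by
    rcases hne with h3 | h3 | ⟨h3, h4, h5⟩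
    · exact posright h.hu (cont_of_hd h.hq) (Or.inl h3)
    · exact posright h.hu (cont_of_hd h.hq) (Or.inr h3)
    · obtain ⟨δ, hδ, hz⟩ := posright h.hz (cont_of_hd h.hr) h5
      exact ⟨δ, hδ, fun t a1 a2 => (aux_spos hb.le a1 h.hu h.hq
        (fun s b1 b2 => hz s b1 (by linarith)) hu hq).1⟩
  obtain ⟨δ, hδ, hup⟩ := hupos
  refine grow6 ha hb hc h hbd hg hg' hδ (fun t a1 a2 => ?_) h1.ge h2.ge hu hq zr
  exact (aux_spos ha.le a1 h.hw h.hp (fun s b1 b2 => hup s b1 (by linarith)) h1.ge h2.ge).1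

lemma lemmaZ {a b c M : ℝ} {w p u q z r g : ℝ → ℝ} (ha : 0 < a) (hb : 0 < b) (hc : 0 < c)
    (h : Sys6 a b c w p u q z r g) (hbd : Bd6 M w p u q z r)
    (hg : ∀ t, 0 ≤ w t → 0 ≤ g t) (hg' : ∀ t, w t ≤ 0 → g t ≤ 0) {t0 : ℝ}
    (h1 : w t0 = 0) (h2 : p t0 = 0)
    (h3 : (u t0 = 0 ∧ z t0 = 0) ∨ (q t0 = 0 ∧ r t0 = 0)) :
    u t0 = 0 ∧ q t0 = 0 ∧ z t0 = 0 ∧ r t0 = 0 := by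
  have P := @coneZ a b c M w p u q z r g ha hb hc h hbd hg hg' t0 h1 h2
  have N := @coneZ a b c M _ _ _ _ _ _ _ ha hb hc h.neg hbd.neg
    (fun t ht => by have := hg' t (by linarith); linarith)
    (fun t ht => by have := hg t (by linarith); linarith) t0 (by linarith) (by linarith)
  rcases h3 with ⟨e1, e2⟩ | ⟨e1, e2⟩
  · have hq : q t0 = 0 := by
      rcases lt_trichotomy (q t0) 0 with hq | hq | hq
      · exfalso
        refine N (by linarith) (by linarith) ?_ (Or.inr (Or.inl ⟨by linarith, by linarith⟩))
        rcases le_total (r t0) 0 with e | e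
        · exact Or.inl ⟨by linarith, by linarith⟩
        · exact Or.inr ⟨by linarith, by linarith⟩
      · exact hq
      · exfalso
        refine P (by linarith) (by linarith) ?_ (Or.inr (Or.inl ⟨by linarith, by linarith⟩))
        rcases le_total (r t0) 0 with e | e
        · exact Or.inr ⟨by linarith, by linarith⟩
        · exact Or.inl ⟨by linarith, by linarith⟩
    refine ⟨e1, hq, e2, ?_⟩
    rcases lt_trichotomy (r t0) 0 with hr | hr | hr
    · exfalso
      exact N (by linarith) (by linarith) (Or.inl ⟨by linarith, by linarith⟩)
        (Or.inr (Or.inr ⟨by linarith, by linarith, Or.inr ⟨by linarith, by linarith⟩⟩))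
    · exact hr
    · exfalso
      exact P (by linarith) (by linarith) (Or.inl ⟨by linarith, by linarith⟩)
        (Or.inr (Or.inr ⟨by linarith, by linarith, Or.inr ⟨by linarith, by linarith⟩⟩))
  · have hu : u t0 = 0 := by
      rcases lt_trichotomy (u t0) 0 with hq | hq | hq
      · exfalso
        refine N (by linarith) (by linarith) ?_ (Or.inl (by linarith))
        rcases le_total (z t0) 0 with e | e
        · exact Or.inl ⟨by linarith, by linarith⟩
        · exact Or.inr ⟨by linarith, by linarith⟩
      · exact hq
      · exfalso
        refine P (by linarith) (by linarith) ?_ (Or.inl (by linarith))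
        rcases le_total (z t0) 0 with e | e
        · exact Or.inr ⟨by linarith, by linarith⟩
        · exact Or.inl ⟨by linarith, by linarith⟩
    refine ⟨hu, e1, ?_, e2⟩
    rcases lt_trichotomy (z t0) 0 with hr | hr | hr
    · exfalso
      exact N (by linarith) (by linarith) (Or.inl ⟨by linarith, by linarith⟩)
        (Or.inr (Or.inr ⟨by linarith, by linarith, Or.inl (by linarith)⟩))
    · exact hr
    · exfalso
      exact P (by linarith) (by linarith) (Or.inl ⟨by linarith, by linarith⟩)
        (Or.inr (Or.inr ⟨by linarith, by linarith, Or.inl (by linarith)⟩))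

/-! ### Solutions of the nonlinear equation -/

/-- Properties of the nonlinearity that are used. -/
structure NL (k e : ℝ) (f : ℝ → ℝ) : Prop where
  odd : ∀ x, f (-x) = -f x
  mono : StrictMono f
  lip : ∀ M, ∃ K, ∀ x y, |x| ≤ M → |y| ≤ M → |f x - f y| ≤ K * |x - y|
  epos : 0 < e
  below : ∀ x, 0 < x → x < e → f x < k * x
  above : ∀ x, e < x → k * x < f x
  cont : Continuous f
  eqe : f e = k * e

structure Sol (a b c : ℝ) (f : ℝ → ℝ) (w p u q z r : ℝ → ℝ) : Prop where
  sys : Sys6 a b c w p u q z r (fun t => f (w t))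
  bd : ∃ M, Bd6 M w p u q z r

lemma Sol.neg {a b c k e : ℝ} {f w p u q z r : ℝ → ℝ} (hf : NL k e f) (h : Sol a b c f w p u q z r) :
    Sol a b c f (fun t => -w t) (fun t => -p t) (fun t => -u t) (fun t => -q t) (fun t => -z t)
      (fun t => -r t) := by
  obtain ⟨M, hM⟩ := h.bd
  refine ⟨?_, M, hM.neg⟩
  have := h.sys.neg
  simpa only [← hf.odd] using this

lemma Sol.refl {a b c : ℝ} {f w p u q z r : ℝ → ℝ} (s : ℝ) (h : Sol a b c f w p u q z r) :
    Sol a b c f (fun t => w (s - t)) (fun t => -p (s - t)) (fun t => u (s - t))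
      (fun t => -q (s - t)) (fun t => z (s - t)) (fun t => -r (s - t)) := by
  obtain ⟨M, hM⟩ := h.bd
  exact ⟨h.sys.refl s, M, hM.refl s⟩

lemma Sol.unique {a b c k e : ℝ} {f w p u q z r w' p' u' q' z' r' : ℝ → ℝ} (hf : NL k e f)
    (h : Sol a b c f w p u q z r) (h' : Sol a b c f w' p' u' q' z' r') {t0 : ℝ}
    (h1 : w t0 = w' t0) (h2 : p t0 = p' t0) (h3 : u t0 = u' t0) (h4 : q t0 = q' t0)
    (h5 : z t0 = z' t0) (h6 : r t0 = r' t0) : ∀ t, w t = w' t := by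
  obtain ⟨M, hM⟩ := h.bd
  obtain ⟨M', hM'⟩ := h'.bd
  obtain ⟨K, hK⟩ := hf.lip (max M M')
  intro t
  have := (h.sys.sub h'.sys).unique (K := K)
    (fun t => hK _ _ ((hM.hw t).trans (le_max_left _ _)) ((hM'.hw t).trans (le_max_right _ _)))
    (t0 := t0) (by linarith) (by linarith) (by linarith) (by linarith) (by linarith) (by linarith) t
  linarith

lemma Sol.uniqueZ {a b c k e : ℝ} {f w p u q z r w' p' u' q' z' r' : ℝ → ℝ}
    (ha : 0 < a) (hb : 0 < b) (hc : 0 < c) (hf : NL k e f)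
    (h : Sol a b c f w p u q z r) (h' : Sol a b c f w' p' u' q' z' r') {t0 : ℝ}
    (h1 : w t0 = w' t0) (h2 : p t0 = p' t0)
    (h3 : (u t0 = u' t0 ∧ z t0 = z' t0) ∨ (q t0 = q' t0 ∧ r t0 = r' t0)) : ∀ t, w t = w' t := by
  obtain ⟨M, hM⟩ := h.bd
  obtain ⟨M', hM'⟩ := h'.bd
  obtain ⟨e1, e2, e3, e4⟩ := lemmaZ (t0 := t0) ha hb hc (h.sys.sub h'.sys) (hM.sub hM')
    (fun t ht => by have := hf.mono.monotone (show w' t ≤ w t by linarith); linarith)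
    (fun t ht => by have := hf.mono.monotone (show w t ≤ w' t by linarith); linarith)
    (by linarith) (by linarith) (by
      rcases h3 with h3 | h3
      · left; constructor <;> linarith [h3.1, h3.2]
      · right; constructor <;> linarith [h3.1, h3.2])
  exact h.unique hf h' (t0 := t0) h1 h2 (by linarith) (by linarith) (by linarith) (by linarith)

/-- even symmetry about critical points -/
lemma Sol.even {a b c k e : ℝ} {f w p u q z r : ℝ → ℝ}
    (ha : 0 < a) (hb : 0 < b) (hc : 0 < c) (hf : NL k e f)
    (h : Sol a b c f w p u q z r) {t0 : ℝ} (h0 : p t0 = 0) : ∀ t, w t = w (2 * t0 - t) := by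
  have e : 2 * t0 - t0 = t0 := by ring
  exact h.uniqueZ ha hb hc hf (h.refl (2 * t0)) (t0 := t0) (by rw [e]) (by rw [e]; linarith)
    (Or.inl ⟨by rw [e], by rw [e]⟩)

/-- odd symmetry about zeros -/
lemma Sol.oddz {a b c k e : ℝ} {f w p u q z r : ℝ → ℝ}
    (ha : 0 < a) (hb : 0 < b) (hc : 0 < c) (hf : NL k e f)
    (h : Sol a b c f w p u q z r) {t0 : ℝ} (h0 : w t0 = 0) : ∀ t, w t = - w (2 * t0 - t) := by
  have e : 2 * t0 - t0 = t0 := by ring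
  exact h.uniqueZ ha hb hc hf ((h.refl (2 * t0)).neg hf) (t0 := t0) (by rw [e]; linarith)
    (by rw [e]; linarith)
    (Or.inr ⟨by rw [e]; linarith, by rw [e]; linarith⟩)

/-! ### Limits -/

lemma barb_aux {f p d : ℝ → ℝ} {M L ε : ℝ} (hf : ∀ t, HasDerivAt f (p t) t)
    (hp : ∀ t, HasDerivAt p (d t) t) (hM : ∀ t, |d t| ≤ M) (hL : Tendsto f atTop (𝓝 L))
    (hε : 0 < ε) : ∀ᶠ t in atTop, p t < ε := by
  have hM0 : 0 ≤ M := (abs_nonneg _).trans (hM 0)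
  set δ := ε / (2 * (M + 1)) with hδ
  have hδ0 : 0 < δ := by positivity
  have hMδ : M * δ ≤ ε / 2 := by
    have : (M + 1) * δ = ε / 2 := by rw [hδ]; field_simp
    nlinarith
  have h1 : ∀ᶠ t in atTop, |f t - L| < ε * δ / 8 := by
    have := Metric.tendsto_nhds.1 hL (ε * δ / 8) (by positivity)
    simpa [Real.dist_eq] using this
  obtain ⟨N, hN⟩ := eventually_atTop.1 h1
  filter_upwards [eventually_ge_atTop N] with t ht
  by_contra hcon
  push Not at hcon
  have h2 : ∀ s, t < s → s < t + δ → ε / 2 ≤ p s := by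
    intro s a1 a2
    have := aux_grow a1.le hp (fun x _ _ => (abs_le.1 (hM x)).1)
    have h3 : M * (s - t) ≤ M * δ := by gcongr; linarith
    linarith
  have h3 := aux_grow (by linarith : t ≤ t + δ) hf h2
  have h4 := abs_lt.1 (hN t ht)
  have h5 := abs_lt.1 (hN (t + δ) (by linarith))
  have h6 : 0 < ε * δ := by positivity
  nlinarith

lemma barb {f p d : ℝ → ℝ} {M L : ℝ} (hf : ∀ t, HasDerivAt f (p t) t)
    (hp : ∀ t, HasDerivAt p (d t) t) (hM : ∀ t, |d t| ≤ M) (hL : Tendsto f atTop (𝓝 L)) :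
    Tendsto p atTop (𝓝 0) := by
  rw [Metric.tendsto_nhds]
  intro ε hε
  filter_upwards [barb_aux hf hp hM hL hε, barb_aux (f := fun t => -f t) (p := fun t => -p t)
    (d := fun t => - d t) (M := M) (fun t => (hf t).neg) (fun t => (hp t).neg)
    (fun t => by simpa using hM t) hL.neg hε] with t h1 h2
  rw [Real.dist_eq, sub_zero, abs_lt]
  constructor <;> linarith

lemma lim_deriv_zero_aux {f p : ℝ → ℝ} {M L : ℝ} (hf : ∀ t, HasDerivAt f (p t) t)
    (hM : ∀ t, |f t| ≤ M) (hL : Tendsto p atTop (𝓝 L)) : L ≤ 0 := by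
  by_contra hcon
  push Not at hcon
  have : ∀ᶠ t in atTop, L / 2 < p t := hL.eventually (lt_mem_nhds (by linarith))
  obtain ⟨N, hN⟩ := eventually_atTop.1 this
  have hM0 : 0 ≤ M := (abs_nonneg _).trans (hM 0)
  have h0 : 0 ≤ (2 * M + 1) / (L / 2) := by positivity
  have h1 := aux_grow (x := N) (y := N + (2 * M + 1) / (L / 2)) (by linarith) hf
    (fun t a _ => (hN t a.le).le)
  have h2 : L / 2 * (N + (2 * M + 1) / (L / 2) - N) = 2 * M + 1 := by
    rw [add_sub_cancel_left, mul_div_cancel₀]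
    linarith
  have h3 := abs_le.1 (hM N)
  have h4 := abs_le.1 (hM (N + (2 * M + 1) / (L / 2)))
  linarith

lemma lim_deriv_zero {f p : ℝ → ℝ} {M L : ℝ} (hf : ∀ t, HasDerivAt f (p t) t)
    (hM : ∀ t, |f t| ≤ M) (hL : Tendsto p atTop (𝓝 L)) : L = 0 := by
  apply le_antisymm (lim_deriv_zero_aux hf hM hL)
  have := lim_deriv_zero_aux (f := fun t => -f t) (p := fun t => -p t) (M := M)
    (fun t => (hf t).neg) (fun t => by simpa using hM t) hL.neg
  linarith

lemma Sol.limits {a b c k e ℓ : ℝ} {f w p u q z r : ℝ → ℝ} (hf : NL k e f)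
    (h : Sol a b c f w p u q z r) (hl : Tendsto w atTop (𝓝 ℓ)) :
    Tendsto p atTop (𝓝 0) ∧ Tendsto u atTop (𝓝 (-(a ^ 2 * ℓ))) ∧ Tendsto q atTop (𝓝 0) ∧
    Tendsto z atTop (𝓝 (a ^ 2 * b ^ 2 * ℓ)) ∧ Tendsto r atTop (𝓝 0) ∧
    f ℓ = a ^ 2 * b ^ 2 * c ^ 2 * ℓ := by
  obtain ⟨M, hM⟩ := h.bd
  have hs := h.sys
  have bdd : ∀ (s : ℝ) (f g : ℝ → ℝ), (∀ t, |f t| ≤ M) → (∀ t, |g t| ≤ M) → 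
      ∀ t, |s ^ 2 * f t + g t| ≤ s ^ 2 * M + M := by
    intro s f g h1 h2 t
    refine (abs_add_le _ _).trans (add_le_add ?_ (h2 t))
    rw [abs_mul, abs_of_nonneg (sq_nonneg s)]
    exact mul_le_mul_of_nonneg_left (h1 t) (sq_nonneg s)
  have hp0 := barb hs.hw hs.hp (bdd a _ _ hM.hw hM.hu) hl
  have hp1 := barb hs.hp (fun t => ((hs.hw t).const_mul _).add (hs.hu t)) (bdd a _ _ hM.hp hM.hq) hp0
  have hu : Tendsto u atTop (𝓝 (-(a ^ 2 * ℓ))) := by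
    have := hp1.sub (hl.const_mul (a ^ 2))
    simpa using this
  have hq0 := barb hs.hu hs.hq (bdd b _ _ hM.hu hM.hz) hu
  have hq1 := barb hs.hq (fun t => ((hs.hu t).const_mul _).add (hs.hz t)) (bdd b _ _ hM.hq hM.hr) hq0
  have hz : Tendsto z atTop (𝓝 (a ^ 2 * b ^ 2 * ℓ)) := by
    have := hq1.sub (hu.const_mul (b ^ 2))
    have h3 : Tendsto z atTop (𝓝 (0 - b ^ 2 * -(a ^ 2 * ℓ))) := this.congr (fun t => by ring)
    refine h3.trans (le_of_eq ?_)
    congr 1; ring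
  have hfl : Tendsto (fun t => f (w t)) atTop (𝓝 (f ℓ)) := (hf.cont.tendsto ℓ).comp hl
  have hr1 : Tendsto (fun t => c ^ 2 * z t + -f (w t)) atTop (𝓝 (c ^ 2 * (a ^ 2 * b ^ 2 * ℓ) + -f ℓ)) :=
    (hz.const_mul _).add hfl.neg
  have hfin := lim_deriv_zero hs.hr hM.hr hr1
  have hfb : ∃ B, ∀ t, |f (w t)| ≤ B := by
    refine ⟨f M, fun t => ?_⟩
    have := abs_le.1 (hM.hw t)
    rw [abs_le, ← hf.odd]
    exact ⟨hf.mono.monotone this.1, hf.mono.monotone this.2⟩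
  obtain ⟨B, hB⟩ := hfb
  have hr0 := barb (M := c ^ 2 * M + B) hs.hz hs.hr (fun t => by
    refine (abs_add_le _ _).trans (add_le_add ?_ (by rw [abs_neg]; exact hB t))
    rw [abs_mul, abs_of_nonneg (sq_nonneg c)]
    exact mul_le_mul_of_nonneg_left (hM.hz t) (sq_nonneg c)) hz
  exact ⟨hp0, hu, hq0, hz, hr0, by linarith⟩

lemma NL.f0 {k e : ℝ} {f : ℝ → ℝ} (hf : NL k e f) : f 0 = 0 := by
  have := hf.odd 0
  simp at this
  linarith

lemma NL.roots {k e x : ℝ} {f : ℝ → ℝ} (hf : NL k e f) (h : f x = k * x) :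
    x = 0 ∨ x = e ∨ x = -e := by
  have key : ∀ x, 0 < x → f x = k * x → x = e := by
    intro x hx h
    rcases lt_trichotomy x e with h1 | h1 | h1
    · have := hf.below x hx h1; linarith
    · exact h1
    · have := hf.above x h1; linarith
  rcases lt_trichotomy x 0 with h1 | h1 | h1
  · right; right
    have := key (-x) (by linarith) (by rw [hf.odd, h]; ring)
    linarith
  · exact Or.inl h1
  · exact Or.inr (Or.inl (key x h1 h))

lemma NL.small {k e x : ℝ} {f : ℝ → ℝ} (hf : NL k e f) (h : |x| ≤ e) : 0 ≤ x * (k * x - f x) := by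
  have key : ∀ x, 0 < x → x ≤ e → 0 ≤ x * (k * x - f x) := by
    intro x hx h
    rcases h.eq_or_lt with h | h
    · rw [h, hf.eqe]; simp
    · have := hf.below x hx h
      exact mul_nonneg hx.le (by linarith)
  rcases lt_trichotomy x 0 with h1 | h1 | h1
  · have := key (-x) (by linarith) (by have := abs_le.1 h; linarith)
    rw [hf.odd] at this
    linarith
  · simp [h1]
  · exact key x h1 (abs_le.1 h).2

lemma mono_zero {G G' : ℝ → ℝ} (hG : ∀ t, HasDerivAt G (G' t) t) (h0 : ∀ t, 0 ≤ G' t)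
    (h1 : Tendsto G atTop (𝓝 0)) (h2 : Tendsto (fun t => G (0 - t)) atTop (𝓝 0)) (t : ℝ) : G' t = 0 := by
  have hm : Monotone G := fun x y hxy => aux_mono hxy hG (fun t _ _ => h0 t)
  have hz : ∀ t, G t = 0 := by
    intro t
    apply le_antisymm (hm.ge_of_tendsto h1 t)
    have : ∀ᶠ s in atTop, G (0 - s) ≤ G t := by
      filter_upwards [eventually_ge_atTop (-t)] with s hs
      exact hm (by linarith)
    exact le_of_tendsto h2 this
  have : G = fun _ => 0 := funext hz
  have h3 := hG t
  rw [this] at h3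
  exact h3.unique (hasDerivAt_const t 0)

lemma Sol.no_small {a b c k e ℓ ℓ' : ℝ} {f w p u q z r : ℝ → ℝ} (hf : NL k e f)
    (ha : 0 < a) (hb : 0 < b) (hk : k = a ^ 2 * b ^ 2 * c ^ 2)
    (h : Sol a b c f w p u q z r) (hl : Tendsto w atTop (𝓝 ℓ))
    (hl' : Tendsto (fun t => w (0 - t)) atTop (𝓝 ℓ')) (hs : ∀ t, |w t| ≤ e) (t : ℝ) : p t = 0 := by
  set Ψ : ℝ → ℝ := fun t => w t * (r t - c ^ 2 * q t + b ^ 2 * c ^ 2 * p t)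
    - p t * (a ^ 2 * (a ^ 2 * w t + u t) + (b ^ 2 * u t + z t)) 
    + (a ^ 2 * w t + u t) * (a ^ 2 * p t + q t)
    + (a ^ 2 + b ^ 2 + c ^ 2) * (p t * (a ^ 2 * w t + u t)) with hΨ
  set Ψ' : ℝ → ℝ := fun t => w t * (k * w t - f (w t)) + (a ^ 2 * p t + q t) ^ 2
    + (a ^ 2 + b ^ 2 + c ^ 2) * (a ^ 2 * w t + u t) ^ 2
    + (a ^ 2 * b ^ 2 + b ^ 2 * c ^ 2 + c ^ 2 * a ^ 2) * p t ^ 2 with hΨ'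
  have hs6 := h.sys
  have hd : ∀ t, HasDerivAt Ψ (Ψ' t) t := by
    intro t
    have dw := hs6.hw t
    have dp := hs6.hp t
    have du := hs6.hu t
    have dq := hs6.hq t
    have dz := hs6.hz t
    have dr := hs6.hr t
    have d2 := (dw.const_mul (a ^ 2)).add du
    have := (((dw.mul ((dr.sub (dq.const_mul (c ^ 2))).add (dp.const_mul (b ^ 2 * c ^ 2)))).sub
      (dp.mul ((d2.const_mul (a ^ 2)).add ((du.const_mul (b ^ 2)).add dz)))).add
      (d2.mul ((dp.const_mul (a ^ 2)).add dq))).add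
      ((dp.mul d2).const_mul (a ^ 2 + b ^ 2 + c ^ 2))
    refine this.congr_deriv ?_
    simp only [hΨ', hk, Pi.add_apply, Pi.sub_apply, Pi.mul_apply]
    ring
  have hnn : ∀ t, 0 ≤ Ψ' t := by
    intro t
    have := hf.small (hs t)
    simp only [hΨ']
    positivity
  obtain ⟨l1, l2, l3, l4, l5, l6⟩ := h.limits hf hl
  obtain ⟨m1, m2, m3, m4, m5, m6⟩ := (h.refl 0).limits hf hl'
  have e1 : Tendsto Ψ atTop (𝓝 0) := by
    have := (((hl.mul ((l5.sub (l3.const_mul (c ^ 2))).add (l1.const_mul (b ^ 2 * c ^ 2)))).sub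
      (l1.mul ((((hl.const_mul (a ^ 2)).add l2).const_mul (a ^ 2)).add ((l2.const_mul (b ^ 2)).add l4)))).add
      (((hl.const_mul (a ^ 2)).add l2).mul ((l1.const_mul (a ^ 2)).add l3))).add
      ((l1.mul ((hl.const_mul (a ^ 2)).add l2)).const_mul (a ^ 2 + b ^ 2 + c ^ 2))
    refine this.trans (le_of_eq ?_)
    congr 1; ring
  have e2 : Tendsto (fun t => Ψ (0 - t)) atTop (𝓝 0) := by
    have m1 := m1.neg
    have m3 := m3.neg
    have m5 := m5.neg
    simp only [neg_neg, neg_zero] at m1 m3 m5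
    have := (((hl'.mul ((m5.sub (m3.const_mul (c ^ 2))).add (m1.const_mul (b ^ 2 * c ^ 2)))).sub
      (m1.mul ((((hl'.const_mul (a ^ 2)).add m2).const_mul (a ^ 2)).add ((m2.const_mul (b ^ 2)).add m4)))).add
      (((hl'.const_mul (a ^ 2)).add m2).mul ((m1.const_mul (a ^ 2)).add m3))).add
      ((m1.mul ((hl'.const_mul (a ^ 2)).add m2)).const_mul (a ^ 2 + b ^ 2 + c ^ 2))
    refine this.trans (le_of_eq ?_)
    congr 1; ring
  have h0 := mono_zero hd hnn e1 e2 t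
  simp only [hΨ'] at h0
  have n1 := hf.small (hs t)
  have n2 : 0 ≤ (a ^ 2 * p t + q t) ^ 2 := by positivity
  have n3 : 0 ≤ (a ^ 2 + b ^ 2 + c ^ 2) * (a ^ 2 * w t + u t) ^ 2 := by positivity
  have n4 : 0 ≤ (b ^ 2 * c ^ 2 + c ^ 2 * a ^ 2) * p t ^ 2 := by positivity
  have n5 : a ^ 2 * b ^ 2 * p t ^ 2 ≤ 0 := by linarith
  have n6 : 0 < a ^ 2 * b ^ 2 := by positivity
  by_contra hcon
  have : 0 < a ^ 2 * b ^ 2 * p t ^ 2 := by positivity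
  linarith

lemma Sol.no_big {a b c k e ℓ ℓ' : ℝ} {f w p u q z r : ℝ → ℝ} (hf : NL k e f)
    (hk : k = a ^ 2 * b ^ 2 * c ^ 2)
    (h : Sol a b c f w p u q z r) (hl : Tendsto w atTop (𝓝 ℓ))
    (hl' : Tendsto (fun t => w (0 - t)) atTop (𝓝 ℓ')) (hs : ∀ t, e ≤ w t) (t : ℝ) : w t = e := by
  have hs6 := h.sys
  have hd : ∀ t, HasDerivAt (fun t => -(r t - c ^ 2 * q t + b ^ 2 * c ^ 2 * p t))
      (f (w t) - k * w t) t := by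
    intro t
    refine (((hs6.hr t).sub ((hs6.hq t).const_mul (c ^ 2))).add
      ((hs6.hp t).const_mul (b ^ 2 * c ^ 2))).neg.congr_deriv ?_
    rw [hk]; ring
  have hnn : ∀ t, 0 ≤ f (w t) - k * w t := by
    intro t
    rcases (hs t).eq_or_lt with h1 | h1
    · rw [← h1, hf.eqe]; simp
    · have := hf.above _ h1; linarith
  obtain ⟨l1, l2, l3, l4, l5, l6⟩ := h.limits hf hl
  obtain ⟨m1, m2, m3, m4, m5, m6⟩ := (h.refl 0).limits hf hl'
  have h0 := mono_zero hd hnn (by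
    have := ((l5.sub (l3.const_mul (c ^ 2))).add (l1.const_mul (b ^ 2 * c ^ 2))).neg
    simpa using this) (by
    have := ((m5.sub (m3.const_mul (c ^ 2))).add (m1.const_mul (b ^ 2 * c ^ 2)))
    refine (this.congr (fun t => by ring)).trans (le_of_eq ?_)
    congr 1; ring) t
  rcases hf.roots (by linarith : f (w t) = k * w t) with h1 | h1 | h1
  · linarith [hs t, hf.epos]
  · exact h1
  · linarith [hs t, hf.epos]

/-! ### Case analysis -/

lemma lim_of_mono {w p : ℝ → ℝ} {T M : ℝ} (hw : ∀ t, HasDerivAt w (p t) t) (hM : ∀ t, |w t| ≤ M)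
    (hp : ∀ t, T < t → 0 ≤ p t) : ∃ ℓ, Tendsto w atTop (𝓝 ℓ) ∧ ∀ t, T ≤ t → w t ≤ ℓ := by
  have hm : Monotone (fun t => w (max t T)) := fun x y hxy =>
    aux_mono (max_le_max_right T hxy) hw (fun t a _ => hp t (lt_of_le_of_lt (le_max_right _ _) a))
  have hb : BddAbove (Set.range fun t => w (max t T)) := by
    refine ⟨M, ?_⟩
    rintro _ ⟨t, rfl⟩
    exact (abs_le.1 (hM _)).2
  have := tendsto_atTop_ciSup hm hb
  refine ⟨_, this.congr' ?_, ?_⟩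
  · filter_upwards [eventually_ge_atTop T] with t ht
    rw [max_eq_left ht]
  · intro t ht
    have := le_ciSup hb t
    rwa [max_eq_left ht] at this

lemma lim_of_anti {w p : ℝ → ℝ} {T M : ℝ} (hw : ∀ t, HasDerivAt w (p t) t) (hM : ∀ t, |w t| ≤ M)
    (hp : ∀ t, T < t → p t ≤ 0) : ∃ ℓ, Tendsto w atTop (𝓝 ℓ) ∧ ∀ t, T ≤ t → ℓ ≤ w t := by
  obtain ⟨ℓ, h1, h2⟩ := lim_of_mono (w := fun t => -w t) (p := fun t => -p t) (M := M) (T := T)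
    (fun t => (hw t).neg) (fun t => by simpa using hM t) (fun t ht => by have := hp t ht; linarith)
  refine ⟨-ℓ, by simpa using h1.neg, fun t ht => ?_⟩
  have := h2 t ht
  linarith

lemma sign_of_ne {p : ℝ → ℝ} {s : Set ℝ} (hs : IsPreconnected s) (hc : Continuous p)
    (h : ∀ t ∈ s, p t ≠ 0) : (∀ t ∈ s, 0 < p t) ∨ (∀ t ∈ s, p t < 0) := by
  by_contra hcon
  push Not at hcon
  obtain ⟨⟨x, hx, hx'⟩, y, hy, hy'⟩ := hcon
  obtain ⟨t, ht, ht'⟩ := hs.intermediate_value hx hy hc.continuousOn ⟨hx', hy'⟩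
  exact h t ht ht'

lemma const_of_deriv {w p : ℝ → ℝ} (hw : ∀ t, HasDerivAt w (p t) t) (h0 : ∀ t, p t = 0) (t : ℝ) :
    w t = w 0 := by
  apply is_const_of_deriv_eq_zero (fun t => (hw t).differentiableAt)
  intro t
  rw [(hw t).deriv, h0]

/-- no critical point, increasing: impossible -/
lemma Sol.nocrit {a b c k e : ℝ} {f w p u q z r : ℝ → ℝ} (hf : NL k e f)
    (ha : 0 < a) (hb : 0 < b) (hk : k = a ^ 2 * b ^ 2 * c ^ 2)
    (h : Sol a b c f w p u q z r) (hp : ∀ t, 0 < p t) : False := by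
  obtain ⟨M, hM⟩ := h.bd
  have h' := h.refl 0
  obtain ⟨M', hM'⟩ := h'.bd
  have key : ∀ {w p : ℝ → ℝ}, (∀ t, HasDerivAt w (p t) t) → (∀ t, |w t| ≤ M) → (∀ t, 0 < p t) →
      ∃ ℓ, Tendsto w atTop (𝓝 ℓ) ∧ ∀ t, w t ≤ ℓ := by
    intro w p hw hM hp
    have hm : Monotone w := fun x y hxy => aux_mono hxy hw (fun t _ _ => (hp t).le)
    obtain ⟨ℓ, h1, -⟩ := lim_of_mono (T := 0) hw hM (fun t _ => (hp t).le)
    exact ⟨ℓ, h1, hm.ge_of_tendsto h1⟩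
  obtain ⟨ℓ, l1, l2⟩ := key h.sys.hw hM.hw hp
  obtain ⟨ℓ', m1, m2⟩ := key (w := fun t => - w (0 - t)) (p := fun t => p (0 - t))
    (fun t => (hasDerivAt_refl_aux (h.sys.hw (0 - t))).neg.congr_deriv (by ring))
    (fun t => by rw [abs_neg]; exact hM.hw _) (fun t => hp _)
  have m1' : Tendsto (fun t => w (0 - t)) atTop (𝓝 (-ℓ')) := by simpa using m1.neg
  have r1 := hf.roots (x := ℓ) (by rw [hk]; exact (h.limits hf l1).2.2.2.2.2)
  have r2 := hf.roots (x := -ℓ') (by rw [hk]; exact (h'.limits hf m1').2.2.2.2.2)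
  have he := hf.epos
  have := h.no_small hf ha hb hk l1 m1' (fun t => by
    rw [abs_le]
    have i1 := l2 t
    have i2 := m2 (-t)
    simp only [sub_neg_eq_add, zero_add] at i2
    constructor
    · rcases r2 with r | r | r <;> linarith
    · rcases r1 with r | r | r <;> linarith) 0
  linarith [hp 0]

lemma Sol.onecrit {a b c k e T : ℝ} {f w p u q z r : ℝ → ℝ} (hf : NL k e f)
    (ha : 0 < a) (hb : 0 < b) (hc : 0 < c) (hk : k = a ^ 2 * b ^ 2 * c ^ 2)
    (h : Sol a b c f w p u q z r) (hT : p T = 0) (hT' : ∀ t, p t = 0 → t = T)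
    (hpos : ∀ t, 0 < w t) : Tendsto w atTop (𝓝 0) := by
  obtain ⟨M, hM⟩ := h.bd
  have hev := h.even ha hb hc hf hT
  have he := hf.epos
  have hrefl : ∀ {ℓ}, Tendsto w atTop (𝓝 ℓ) → Tendsto (fun t => w (0 - t)) atTop (𝓝 ℓ) := by
    intro ℓ hl
    have h1 : Tendsto (fun t => 2 * T + t) atTop atTop := tendsto_atTop_add_const_left _ _ tendsto_id
    refine (hl.comp h1).congr (fun t => ?_)
    simp only [Function.comp]
    rw [hev (0 - t)]
    congr 1; ring
  have hnc : ¬ (∀ t, p t = 0) := by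
    intro h0
    have := hT' (T + 1) (h0 _)
    linarith
  have hfold : ∀ (P : ℝ → Prop), (∀ t, T ≤ t → P (w t)) → ∀ t, P (w t) := by
    intro P hP t
    rcases le_total T t with h1 | h1
    · exact hP t h1
    · rw [hev t]; exact hP _ (by linarith)
  rcases sign_of_ne (isPreconnected_Ioi (a := T)) (cont_of_hd h.sys.hp) (fun t ht h0 => by
    have := hT' t h0
    have ht' : T < t := ht
    linarith) with hs | hs
  · obtain ⟨ℓ, l1, l2⟩ := lim_of_mono h.sys.hw hM.hw (fun t ht => (hs t ht).le)
    rcases hf.roots (x := ℓ) (by rw [hk]; exact (h.limits hf l1).2.2.2.2.2) with r | r | r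
    · rwa [r] at l1
    · exfalso
      refine hnc (h.no_small hf ha hb hk l1 (hrefl l1) ?_)
      refine hfold (fun x => |x| ≤ e) (fun t ht => ?_)
      rw [abs_of_pos (hpos t), ← r]
      exact l2 t ht
    · have := l2 T le_rfl
      have := hpos T
      linarith
  · obtain ⟨ℓ, l1, l2⟩ := lim_of_anti h.sys.hw hM.hw (fun t ht => (hs t ht).le)
    rcases hf.roots (x := ℓ) (by rw [hk]; exact (h.limits hf l1).2.2.2.2.2) with r | r | r
    · rwa [r] at l1
    · exfalso
      have hc := h.no_big hf hk l1 (hrefl l1) (hfold (fun x => e ≤ x) (fun t ht => by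
        rw [← r]; exact l2 t ht))
      refine hnc (fun t => ?_)
      have h3 := h.sys.hw t
      rw [funext hc] at h3
      exact h3.unique (hasDerivAt_const t e)
    · exfalso
      have : ∀ᶠ t in atTop, w t < 0 := l1.eventually (gt_mem_nhds (by linarith))
      obtain ⟨t, ht⟩ := this.exists
      linarith [hpos t]

theorem Sol.classify {a b c k e : ℝ} {f w p u q z r : ℝ → ℝ} (hf : NL k e f)
    (ha : 0 < a) (hb : 0 < b) (hc : 0 < c) (hk : k = a ^ 2 * b ^ 2 * c ^ 2)
    (h : Sol a b c f w p u q z r) :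
    (∃ x, (x = 0 ∨ x = e ∨ x = -e) ∧ ∀ t, w t = x) ∨
    ((¬ ∃ x, ∀ t, w t = x) ∧ ∃ T, 0 < T ∧ ∀ t, w (t + T) = w t) ∨
    ((∀ t, 0 < w t) ∧ Tendsto w atTop (𝓝 0)) ∨ ((∀ t, w t < 0) ∧ Tendsto w atTop (𝓝 0)) := by
  by_cases hcon : ∃ x, ∀ t, w t = x
  · left
    obtain ⟨x, hx⟩ := hcon
    have hl : Tendsto w atTop (𝓝 x) := by
      rw [funext hx]; exact tendsto_const_nhds
    exact ⟨x, hf.roots (by rw [hk]; exact (h.limits hf hl).2.2.2.2.2), hx⟩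
  right
  by_cases hper : ∃ T, 0 < T ∧ ∀ t, w (t + T) = w t
  · exact Or.inl ⟨hcon, hper⟩
  right
  have hper2 : ∀ t0 t1, t0 < t1 → p t0 = 0 → p t1 = 0 → False := by
    intro t0 t1 h01 h0 h1
    refine hper ⟨2 * (t1 - t0), by linarith, fun t => ?_⟩
    rw [h.even ha hb hc hf h1 (t + 2 * (t1 - t0)), h.even ha hb hc hf h0 t]
    congr 1; ring
  have huniq : ∀ t0 t1, p t0 = 0 → p t1 = 0 → t0 = t1 := by
    intro t0 t1 h0 h1
    rcases lt_trichotomy t0 t1 with e | e | e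
    · exact (hper2 _ _ e h0 h1).elim
    · exact e
    · exact (hper2 _ _ e h1 h0).elim
  have hcrit : ∃ T, p T = 0 := by
    by_contra hno
    push Not at hno
    rcases sign_of_ne isPreconnected_univ (cont_of_hd h.sys.hp) (fun t _ => hno t) with hs | hs
    · exact h.nocrit hf ha hb hk (fun t => hs t trivial)
    · exact (h.neg hf).nocrit hf ha hb hk (fun t => by have := hs t trivial; linarith)
  obtain ⟨T, hT⟩ := hcrit
  have hnz : ∀ t, w t ≠ 0 := by
    intro t0 h0
    have ho := h.oddz ha hb hc hf h0
    have hp' : p T = p (2 * t0 - T) := by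
      have h1 := h.sys.hw T
      have h2 := (hasDerivAt_refl_aux (h.sys.hw (2 * t0 - T))).neg
      have h3 : w = fun t => -w (2 * t0 - t) := funext ho
      have h2' : HasDerivAt w (- -p (2 * t0 - T)) T := by
        rw [h3]
        exact h2
      have := h1.unique h2'
      linarith
    have h4 := huniq T (2 * t0 - T) hT (by linarith)
    have h5 : t0 = T := by linarith
    have hev := h.even ha hb hc hf hT
    apply hcon
    refine ⟨0, fun t => ?_⟩
    have h6 := ho t
    have h7 := hev t
    rw [h5] at h6
    linarith
  have hu' : ∀ t, p t = 0 → t = T := fun t ht => huniq t T ht hT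
  rcases sign_of_ne isPreconnected_univ (cont_of_hd h.sys.hw) (fun t _ => hnz t) with hs | hs
  · left
    exact ⟨fun t => hs t trivial, h.onecrit hf ha hb hc hk hT hu' (fun t => hs t trivial)⟩
  · right
    refine ⟨fun t => hs t trivial, ?_⟩
    have := (h.neg hf).onecrit (T := T) hf ha hb hc hk (by linarith)
      (fun t ht => hu' t (by linarith)) (fun t => by have := hs t trivial; linarith)
    simpa using this.neg

/-! ### Asymptotics of second order equations -/

lemma lim_of_mono' {w p : ℝ → ℝ} {T M : ℝ} (hw : ∀ t, HasDerivAt w (p t) t)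
    (hM : ∀ t, T ≤ t → w t ≤ M)
    (hp : ∀ t, T < t → 0 ≤ p t) : ∃ ℓ, Tendsto w atTop (𝓝 ℓ) ∧ ∀ t, T ≤ t → w t ≤ ℓ := by
  have hm : Monotone (fun t => w (max t T)) := fun x y hxy =>
    aux_mono (max_le_max_right T hxy) hw (fun t a _ => hp t (lt_of_le_of_lt (le_max_right _ _) a))
  have hb : BddAbove (Set.range fun t => w (max t T)) := by
    refine ⟨M, ?_⟩
    rintro _ ⟨t, rfl⟩
    exact hM _ (le_max_right _ _)
  have := tendsto_atTop_ciSup hm hb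
  refine ⟨_, this.congr' ?_, ?_⟩
  · filter_upwards [eventually_ge_atTop T] with t ht
    rw [max_eq_left ht]
  · intro t ht
    have := le_ciSup hb t
    rwa [max_eq_left ht] at this

lemma le_lim_of_mono {w p : ℝ → ℝ} {T L : ℝ} (hw : ∀ t, HasDerivAt w (p t) t)
    (hL : Tendsto w atTop (𝓝 L))
    (hp : ∀ t, T < t → 0 ≤ p t) : ∀ t, T ≤ t → w t ≤ L := by
  intro t ht
  have : ∀ᶠ s in atTop, w t ≤ w s := by
    filter_upwards [eventually_ge_atTop t] with s hs
    exact aux_mono hs hw (fun x a _ => hp x (by linarith))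
  exact ge_of_tendsto hL this

lemma exp_tendsto {l : ℝ} (hl : 0 < l) : Tendsto (fun t : ℝ => Real.exp (-(l * t))) atTop (𝓝 0) :=
  Real.tendsto_exp_neg_atTop_nhds_zero.comp (tendsto_id.const_mul_atTop hl)

lemma exp_hd (l t : ℝ) : HasDerivAt (fun t : ℝ => Real.exp (-(l * t))) (-(l * Real.exp (-(l * t)))) t := by
  have := ((hasDerivAt_id t).const_mul l).neg.exp
  refine this.congr_deriv ?_
  simp
  ring

lemma conv_lemma {G G' : ℝ → ℝ} {K μ T : ℝ} (hμ : 0 < μ) (hG : ∀ t, HasDerivAt G (G' t) t)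
    (h : ∀ t, T ≤ t → |G' t| ≤ K * μ * Real.exp (-(μ * t))) :
    ∃ L, Tendsto G atTop (𝓝 L) ∧ ∀ t, T ≤ t → |G t - L| ≤ K * Real.exp (-(μ * t)) := by
  have d1 : ∀ t, HasDerivAt (fun t => G t - K * Real.exp (-(μ * t)))
      (G' t + K * μ * Real.exp (-(μ * t))) t := fun t =>
    ((hG t).sub ((exp_hd μ t).const_mul K)).congr_deriv (by ring)
  have d2 : ∀ t, HasDerivAt (fun t => -(G t + K * Real.exp (-(μ * t))))
      (- G' t + K * μ * Real.exp (-(μ * t))) t := fun t =>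
    ((hG t).add ((exp_hd μ t).const_mul K)).neg.congr_deriv (by ring)
  have n1 : ∀ t, T < t → 0 ≤ G' t + K * μ * Real.exp (-(μ * t)) := fun t ht => by
    have := (abs_le.1 (h t ht.le)).1; linarith
  have n2 : ∀ t, T < t → 0 ≤ - G' t + K * μ * Real.exp (-(μ * t)) := fun t ht => by
    have := (abs_le.1 (h t ht.le)).2; linarith
  have hK : 0 ≤ K := by
    have h1 := (abs_nonneg _).trans (h T le_rfl)
    have h2 := Real.exp_pos (-(μ * T))
    have h3 : 0 ≤ K * μ := nonneg_of_mul_nonneg_left h1 h2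
    exact nonneg_of_mul_nonneg_left h3 hμ
  obtain ⟨L, l1, l2⟩ := lim_of_mono' (M := G T + K * Real.exp (-(μ * T))) d1 (fun t ht => by
    have h1 := aux_mono ht d2 (fun s a _ => n2 s a)
    have h2 : 0 ≤ K * Real.exp (-(μ * t)) := by positivity
    linarith) n1
  have hG' : Tendsto G atTop (𝓝 L) := by
    have := l1.add ((exp_tendsto hμ).const_mul K)
    simpa using this
  refine ⟨L, hG', fun t ht => ?_⟩
  have h3 := le_lim_of_mono d2 (L := -L) (by
    have := (hG'.add ((exp_tendsto hμ).const_mul K)).neg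
    simpa using this) n2 t ht
  have h4 := l2 t ht
  rw [abs_le]
  constructor <;> linarith

lemma exp_bdd_tendsto {f p : ℝ → ℝ} {l M : ℝ} (hl : 0 < l)
    (hM : ∀ t, |f t| ≤ M) (hM' : ∀ t, |p t| ≤ M) :
    Tendsto (fun t => Real.exp (-(l * t)) * (p t + l * f t)) atTop (𝓝 0) := by
  have h1 := (exp_tendsto hl).mul_const (M + l * M)
  rw [zero_mul] at h1
  refine squeeze_zero_norm (fun t => ?_) h1
  rw [Real.norm_eq_abs, abs_mul, abs_of_pos (Real.exp_pos _)]
  refine mul_le_mul_of_nonneg_left ?_ (Real.exp_pos _).le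
  refine (abs_add_le _ _).trans (add_le_add (hM' t) ?_)
  rw [abs_mul, abs_of_pos hl]
  exact mul_le_mul_of_nonneg_left (hM t) hl.le

lemma lim_lemma {f p h : ℝ → ℝ} {l q H T M : ℝ} (hl : 0 < l) (hq : l < q)
    (hf : ∀ t, HasDerivAt f (p t) t) (hp : ∀ t, HasDerivAt p (l ^ 2 * f t + h t) t)
    (hM : ∀ t, |f t| ≤ M) (hM' : ∀ t, |p t| ≤ M)
    (hh : ∀ t, T ≤ t → |h t| ≤ H * Real.exp (-(q * t))) :
    ∃ L, Tendsto (fun t => Real.exp (l * t) * f t) atTop (𝓝 L) ∧ ∀ t, T ≤ t → 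
      |Real.exp (l * t) * f t - L| ≤ H / (q + l) / (q - l) * Real.exp (-((q - l) * t)) ∧
      |p t + l * f t| ≤ H / (q + l) * Real.exp (-(q * t)) := by
  have hql : 0 < q + l := by linarith
  have hql' : 0 < q - l := by linarith
  obtain ⟨L0, e1, e2⟩ := conv_lemma (T := T) (K := H / (q + l)) (μ := q + l) hql (aux_hd1 hf hp) (by
    intro t ht
    rw [abs_mul, abs_of_pos (Real.exp_pos _), div_mul_cancel₀ _ hql.ne']
    have : Real.exp (-((q + l) * t)) = Real.exp (-(l * t)) * Real.exp (-(q * t)) := by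
      rw [← Real.exp_add]; congr 1; ring
    rw [this]
    calc Real.exp (-(l * t)) * |h t| ≤ Real.exp (-(l * t)) * (H * Real.exp (-(q * t))) :=
          mul_le_mul_of_nonneg_left (hh t ht) (Real.exp_pos _).le
      _ = _ := by ring)
  have hL0 : L0 = 0 := tendsto_nhds_unique e1 (exp_bdd_tendsto hl hM hM')
  have e3 : ∀ t, T ≤ t → |p t + l * f t| ≤ H / (q + l) * Real.exp (-(q * t)) := by
    intro t ht
    have := e2 t ht
    rw [hL0, sub_zero, abs_mul, abs_of_pos (Real.exp_pos _)] at this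
    have h2 : Real.exp (-((q + l) * t)) = Real.exp (-(l * t)) * Real.exp (-(q * t)) := by
      rw [← Real.exp_add]; congr 1; ring
    rw [h2] at this
    refine le_of_mul_le_mul_left ?_ (Real.exp_pos (-(l * t)))
    linarith
  obtain ⟨L, e4, e5⟩ := conv_lemma (T := T) (K := H / (q + l) / (q - l)) (μ := q - l) hql'
    (aux_hd2 (l := l) hf) (by
    intro t ht
    rw [abs_mul, abs_of_pos (Real.exp_pos _), div_mul_cancel₀ _ hql'.ne']
    have : Real.exp (-((q - l) * t)) = Real.exp (l * t) * Real.exp (-(q * t)) := by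
      rw [← Real.exp_add]; congr 1; ring
    rw [this]
    calc Real.exp (l * t) * |p t + l * f t| 
        ≤ Real.exp (l * t) * (H / (q + l) * Real.exp (-(q * t))) :=
          mul_le_mul_of_nonneg_left (e3 t ht) (Real.exp_pos _).le
      _ = _ := by ring)
  exact ⟨L, e4, fun t ht => ⟨e5 t ht, e3 t ht⟩⟩

lemma exp_neg_cancel (l t x : ℝ) : Real.exp (-(l * t)) * (Real.exp (l * t) * x) = x := by
  rw [← mul_assoc, ← Real.exp_add]; simp

/-- consequences in asymptotic form -/
lemma lim_bd {f p h : ℝ → ℝ} {l q H T M : ℝ} (hl : 0 < l) (hq : l < q) (hT : 0 ≤ T)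
    (hf : ∀ t, HasDerivAt f (p t) t) (hp : ∀ t, HasDerivAt p (l ^ 2 * f t + h t) t)
    (hM : ∀ t, |f t| ≤ M) (hM' : ∀ t, |p t| ≤ M)
    (hh : ∀ t, T ≤ t → |h t| ≤ H * Real.exp (-(q * t))) :
    ∃ L H', Tendsto (fun t => Real.exp (l * t) * f t) atTop (𝓝 L) ∧ 
      Tendsto (fun t => Real.exp (l * t) * p t) atTop (𝓝 (-(l * L))) ∧
      ∀ t, T ≤ t → |f t| ≤ H' * Real.exp (-(l * t)) := by
  have hql : 0 < q + l := by linarith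
  have hql' : 0 < q - l := by linarith
  obtain ⟨L, e1, e2⟩ := lim_lemma hl hq hf hp hM hM' hh
  refine ⟨L, |L| + H / (q + l) / (q - l), e1, ?_, ?_⟩
  · have h1 : Tendsto (fun t => Real.exp (l * t) * (p t + l * f t)) atTop (𝓝 0) := by
      have h2 := (exp_tendsto hql').const_mul (H / (q + l))
      rw [mul_zero] at h2
      refine squeeze_zero_norm' ?_ h2
      filter_upwards [eventually_ge_atTop T] with t ht
      rw [Real.norm_eq_abs, abs_mul, abs_of_pos (Real.exp_pos _)]
      have : Real.exp (-((q - l) * t)) = Real.exp (l * t) * Real.exp (-(q * t)) := by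
        rw [← Real.exp_add]; congr 1; ring
      rw [this]
      calc Real.exp (l * t) * |p t + l * f t| 
          ≤ Real.exp (l * t) * (H / (q + l) * Real.exp (-(q * t))) :=
            mul_le_mul_of_nonneg_left (e2 t ht).2 (Real.exp_pos _).le
        _ = _ := by ring
    have h3 := h1.sub (e1.const_mul l)
    rw [zero_sub] at h3
    exact h3.congr (fun t => by ring)
  · intro t ht
    have h1 := (e2 t ht).1
    have hH : 0 ≤ H := by
      have := (abs_nonneg _).trans (hh T le_rfl)
      exact nonneg_of_mul_nonneg_left this (Real.exp_pos _)
    have h2 : Real.exp (-((q - l) * t)) ≤ 1 := by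
      rw [Real.exp_le_one_iff]
      have : 0 ≤ (q - l) * t := mul_nonneg hql'.le (by linarith)
      linarith
    have h3 : |Real.exp (l * t) * f t| ≤ |L| + H / (q + l) / (q - l) := by
      have h4 : H / (q + l) / (q - l) * Real.exp (-((q - l) * t)) ≤ H / (q + l) / (q - l) :=
        mul_le_of_le_one_right (by positivity) h2
      have := abs_sub_abs_le_abs_sub (Real.exp (l * t) * f t) L
      linarith
    have h5 : f t = Real.exp (-(l * t)) * (Real.exp (l * t) * f t) := (exp_neg_cancel _ _ _).symm
    rw [h5, abs_mul, abs_of_pos (Real.exp_pos _), mul_comm]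
    exact mul_le_mul_of_nonneg_right h3 (Real.exp_pos _).le

lemma decS {f p h : ℝ → ℝ} {l T M : ℝ} (hl : 0 < l)
    (hf : ∀ t, HasDerivAt f (p t) t) (hp : ∀ t, HasDerivAt p (l ^ 2 * f t + h t) t)
    (hM : ∀ t, |f t| ≤ M) (hM' : ∀ t, |p t| ≤ M)
    (hh : ∀ t, T ≤ t → 0 ≤ h t) : ∀ t, T ≤ t → p t + l * f t ≤ 0 := by
  intro t ht
  have := le_lim_of_mono (aux_hd1 hf hp) (exp_bdd_tendsto hl hM hM')
    (fun t (ht : T < t) => mul_nonneg (Real.exp_pos _).le (hh t ht.le)) t ht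
  by_contra hcon
  push Not at hcon
  have := mul_pos (Real.exp_pos (-(l * t))) hcon
  linarith

lemma decS_strict {f p h : ℝ → ℝ} {l T M : ℝ} (hl : 0 < l)
    (hf : ∀ t, HasDerivAt f (p t) t) (hp : ∀ t, HasDerivAt p (l ^ 2 * f t + h t) t)
    (hM : ∀ t, |f t| ≤ M) (hM' : ∀ t, |p t| ≤ M)
    (hh : ∀ t, T ≤ t → 0 < h t) : ∀ t, T ≤ t → p t + l * f t < 0 := by
  intro t ht
  have h1 := le_lim_of_mono (aux_hd1 hf hp) (exp_bdd_tendsto hl hM hM')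
    (fun t (ht : T < t) => mul_nonneg (Real.exp_pos _).le (hh t ht.le).le) (t + 1) (by linarith)
  have h2 := aux_smono (by linarith : t < t + 1) (aux_hd1 hf hp)
    (fun s a _ => mul_pos (Real.exp_pos _) (hh s (by linarith)))
  by_contra hcon
  push Not at hcon
  have := mul_nonneg (Real.exp_pos (-(l * t))).le hcon
  linarith

lemma posS {f p : ℝ → ℝ} {l T : ℝ} 
    (hf : ∀ t, HasDerivAt f (p t) t) (h0 : Tendsto (fun t => Real.exp (l * t) * f t) atTop (𝓝 0))
    (hh : ∀ t, T ≤ t → p t + l * f t < 0) : ∀ t, T ≤ t → 0 < f t := by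
  intro t ht
  have d : ∀ t, HasDerivAt (fun t => -(Real.exp (l * t) * f t))
    (-(Real.exp (l * t) * (p t + l * f t))) t := fun t => (aux_hd2 hf t).neg
  have hpos : ∀ t, T ≤ t → 0 < -(Real.exp (l * t) * (p t + l * f t)) := fun t ht => by
    have := mul_pos (Real.exp_pos (l * t)) (show 0 < -(p t + l * f t) by linarith [hh t ht])
    linarith
  have h1 := le_lim_of_mono d (L := 0) (by simpa using h0.neg)
    (fun t (ht : T < t) => (hpos t ht.le).le) (t + 1) (by linarith)
  have h2 := aux_smono (by linarith : t < t + 1) d (fun s a _ => hpos s (by linarith))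
  by_contra hcon
  push Not at hcon
  have := mul_nonneg (Real.exp_pos (l * t)).le (show 0 ≤ - f t by linarith)
  linarith

/-- bounded supersolutions on the line are nonnegative -/
lemma pos_line {f p h : ℝ → ℝ} {l M : ℝ} (hl : 0 < l)
    (hf : ∀ t, HasDerivAt f (p t) t) (hp : ∀ t, HasDerivAt p (l ^ 2 * f t + h t) t)
    (hM : ∀ t, |f t| ≤ M) (hM' : ∀ t, |p t| ≤ M) (hh : ∀ t, h t ≤ 0) :
    ∀ t, 0 ≤ p t + l * f t ∧ 0 ≤ f t := by
  have key : ∀ t, 0 ≤ p t + l * f t := by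
    intro t
    have := decS (f := fun t => -f t) (p := fun t => -p t) (h := fun t => -h t) (M := M) (T := t) hl
      (fun t => (hf t).neg) (fun t => (hp t).neg.congr_deriv (by ring))
      (fun t => by simpa using hM t) (fun t => by simpa using hM' t)
      (fun t _ => by linarith [hh t]) t le_rfl
    linarith
  have key2 : ∀ t, 0 ≤ f t := by
    intro t
    have h1 : ∀ s, t ≤ s → Real.exp (-(l * s)) * f (-s) ≤ Real.exp (l * t) * f t ∨ s < -t := by
      intro s hs
      rcases lt_or_ge s (-t) with h | h
      · exact Or.inr h
      left
      have := aux_mono (show -s ≤ t by linarith) (aux_hd2 (l := l) hf)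
        (fun x _ _ => mul_nonneg (Real.exp_pos _).le (key x))
      simpa using this
    have h2 : Tendsto (fun s => Real.exp (-(l * s)) * f (-s)) atTop (𝓝 0) := by
      have h1 := (exp_tendsto hl).mul_const M
      rw [zero_mul] at h1
      refine squeeze_zero_norm (fun t => ?_) h1
      rw [Real.norm_eq_abs, abs_mul, abs_of_pos (Real.exp_pos _)]
      exact mul_le_mul_of_nonneg_left (hM _) (Real.exp_pos _).le
    have h3 : 0 ≤ Real.exp (l * t) * f t := by
      refine le_of_tendsto h2 ?_
      filter_upwards [eventually_ge_atTop t, eventually_ge_atTop (-t)] with s a1 a2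
      rcases h1 s a1 with h | h
      · exact h
      · linarith
    exact nonneg_of_mul_nonneg_right h3 (Real.exp_pos _)
  exact fun t => ⟨key t, key2 t⟩

/-! ### Decay of positive homoclinics -/

/-- growth of the nonlinearity -/
def Gr (κ α : ℝ) (f : ℝ → ℝ) : Prop :=
  ∀ x y, |f x - f y| ≤ κ * (max |x| |y|) ^ α * |x - y|

lemma Sol.signs {a b c k e : ℝ} {f w p u q z r : ℝ → ℝ} (hf : NL k e f)
    (ha : 0 < a) (hb : 0 < b) (hc : 0 < c)
    (h : Sol a b c f w p u q z r) (hpos : ∀ t, 0 < w t) (t : ℝ) :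
    0 ≤ z t ∧ u t ≤ 0 ∧ 0 ≤ p t + a * w t := by
  obtain ⟨M, hM⟩ := h.bd
  have hfp : ∀ t, 0 ≤ f (w t) := fun t => by
    have := hf.mono.monotone (hpos t).le
    rwa [hf.f0] at this
  have hz := pos_line hc h.sys.hz h.sys.hr hM.hz hM.hr (fun t => by linarith [hfp t])
  have hu := pos_line (f := fun t => -u t) (p := fun t => -q t) (h := fun t => -z t) (M := M) hb
    (fun t => (h.sys.hu t).neg) (fun t => (h.sys.hq t).neg.congr_deriv (by ring))
    (fun t => by simpa using hM.hu t) (fun t => by simpa using hM.hq t)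
    (fun t => by linarith [(hz t).2])
  have hw := pos_line ha h.sys.hw h.sys.hp hM.hw hM.hp (fun t => by linarith [(hu t).2])
  exact ⟨(hz t).2, by linarith [(hu t).2], (hw t).1⟩

lemma Sol.decay {a b c k e κ α σ : ℝ} {f w p u q z r : ℝ → ℝ} (hf : NL k e f) (hgr : Gr κ α f)
    (hα : 0 < α) (ha : 0 < a) (hab : a < b) (hbc : b < c) (hσ : 0 < σ) (hσa : σ < a)
    (h : Sol a b c f w p u q z r) (hpos : ∀ t, 0 < w t) (hl : Tendsto w atTop (𝓝 0)) :
    ∃ T H, 0 ≤ T ∧ ∀ t, T ≤ t → w t ≤ H * Real.exp (-(σ * t)) := by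
  have hb : 0 < b := by linarith
  have hc : 0 < c := by linarith
  have hs := fun t => h.signs hf ha hb hc hpos t
  obtain ⟨M, hM⟩ := h.bd
  set m1 := c ^ 2 - a ^ 2 with hm1
  set m2 := (b ^ 2 - a ^ 2) * (c ^ 2 - a ^ 2) with hm2
  have hm1p : 0 < m1 := by nlinarith
  have hm2p : 0 < m2 := mul_pos (by nlinarith) hm1p
  set X : ℝ → ℝ := fun t => m2 * w t - m1 * u t + z t with hX
  set Y : ℝ → ℝ := fun t => m2 * p t - m1 * q t + r t with hY
  have dX : ∀ t, HasDerivAt X (Y t) t := fun t =>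
    (((h.sys.hw t).const_mul m2).sub ((h.sys.hu t).const_mul m1)).add (h.sys.hz t)
  have dY : ∀ t, HasDerivAt Y (σ ^ 2 * X t + ((a ^ 2 - σ ^ 2) * X t - f (w t))) t := fun t => by
    refine ((((h.sys.hp t).const_mul m2).sub ((h.sys.hq t).const_mul m1)).add
      (h.sys.hr t)).congr_deriv ?_
    simp only [hX, hm2, hm1]
    ring
  have hXw : ∀ t, m2 * w t ≤ X t := fun t => by
    have := mul_nonneg hm1p.le (show 0 ≤ -u t by linarith [(hs t).2.1])
    simp only [hX]
    linarith [(hs t).1]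
  have bd3 : ∀ (f g h : ℝ → ℝ), (∀ t, |f t| ≤ M) → (∀ t, |g t| ≤ M) → (∀ t, |h t| ≤ M) →
      ∀ t, |m2 * f t - m1 * g t + h t| ≤ m2 * M + m1 * M + M := by
    intro f g h h1 h2 h3 t
    refine (abs_add_le _ _).trans (add_le_add ((abs_sub _ _).trans (add_le_add ?_ ?_)) (h3 t))
    · rw [abs_mul, abs_of_pos hm2p]; exact mul_le_mul_of_nonneg_left (h1 t) hm2p.le
    · rw [abs_mul, abs_of_pos hm1p]; exact mul_le_mul_of_nonneg_left (h2 t) hm1p.le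
  have hη : 0 < (a ^ 2 - σ ^ 2) * m2 := mul_pos (by nlinarith) hm2p
  have hev : ∀ᶠ t in atTop, f (w t) ≤ (a ^ 2 - σ ^ 2) * m2 * w t := by
    have h1 : Tendsto (fun t => κ * (w t) ^ α) atTop (𝓝 0) := by
      have h2 : Tendsto (fun t => (w t) ^ α) atTop (𝓝 0) := by
        have := hl.rpow_const (p := α) (Or.inr hα.le)
        rwa [Real.zero_rpow hα.ne'] at this
      simpa using h2.const_mul κ
    filter_upwards [h1.eventually (gt_mem_nhds hη)] with t ht
    have h3 := hgr (w t) 0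
    rw [hf.f0, sub_zero, sub_zero, abs_zero, max_eq_left (abs_nonneg _), abs_of_pos (hpos t)] at h3
    have h4 := (le_abs_self _).trans h3
    refine h4.trans ?_
    exact mul_le_mul_of_nonneg_right ht.le (hpos t).le
  obtain ⟨T0, hT0⟩ := eventually_atTop.1 hev
  set T := max T0 0 with hT
  have hd := decS (T := T) hσ dX dY (bd3 _ _ _ hM.hw hM.hu hM.hz) (bd3 _ _ _ hM.hp hM.hq hM.hr) (by
    intro t ht
    have h1 := hT0 t ((le_max_left _ _).trans ht)
    have h2 : (a ^ 2 - σ ^ 2) * (m2 * w t) ≤ (a ^ 2 - σ ^ 2) * X t :=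
      mul_le_mul_of_nonneg_left (hXw t) (by nlinarith)
    linarith)
  refine ⟨T, Real.exp (σ * T) * X T / m2, le_max_right _ _, fun t ht => ?_⟩
  have h1 := aux_anti ht (aux_hd2 (l := σ) dX) (fun s a _ =>
    mul_nonpos_of_nonneg_of_nonpos (Real.exp_pos _).le (hd s a.le))
  have h2 : X t ≤ Real.exp (σ * T) * X T * Real.exp (-(σ * t)) := by
    have := mul_le_mul_of_nonneg_left h1 (Real.exp_pos (-(σ * t))).le
    rw [exp_neg_cancel] at this
    linarith
  rw [div_mul_eq_mul_div, le_div_iff₀ hm2p]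
  linarith [hXw t]

/-- Precise asymptotics of a positive homoclinic. -/
lemma Sol.asymp {a b c k e κ : ℝ} {f w p u q z r : ℝ → ℝ} (hf : NL k e f)
    (hgr : Gr κ (6 / a) f) (hκ : 0 ≤ κ)
    (ha : 0 < a) (hb : b = a + 2) (hc : c = a + 4)
    (h : Sol a b c f w p u q z r) (hpos : ∀ t, 0 < w t) (hl : Tendsto w atTop (𝓝 0)) :
    ∃ A, 0 < A ∧ Tendsto (fun t => Real.exp (a * t) * w t) atTop (𝓝 A) ∧
      ∃ T H, 0 ≤ T ∧ 0 ≤ H ∧ ∀ t, T ≤ t → w t ≤ H * Real.exp (-(a * t)) := by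
  obtain ⟨M, hM⟩ := h.bd
  have hb0 : 0 < b := by linarith
  have hc0 : 0 < c := by linarith
  have hα : 0 < 6 / a := by positivity
  set σ := a * (a + 5) / (a + 6) with hσ
  have hσ0 : 0 < σ := by positivity
  have hσa : σ < a := by
    rw [hσ, div_lt_iff₀ (by positivity)]
    nlinarith
  have hσq : σ * (6 / a) + σ = a + 5 := by
    rw [hσ]; field_simp; ring
  obtain ⟨T, H, hT, hH⟩ := h.decay hf hgr hα ha (by linarith) (by linarith) hσ0 hσa hpos hl
  have hH0 : 0 ≤ H := by
    have := (hpos T).le.trans (hH T le_rfl)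
    exact nonneg_of_mul_nonneg_left this (Real.exp_pos _)
  have hg : ∀ t, T ≤ t → |-f (w t)| ≤ κ * H ^ (6 / a) * H * Real.exp (-((a + 5) * t)) := by
    intro t ht
    have h3 := hgr (w t) 0
    rw [hf.f0, sub_zero, sub_zero, abs_zero, max_eq_left (abs_nonneg _), abs_of_pos (hpos t)] at h3
    rw [abs_neg]
    refine h3.trans ?_
    have h4 := hH t ht
    have h5 : (w t) ^ (6 / a) ≤ H ^ (6 / a) * Real.exp (-(σ * t) * (6 / a)) := by
      refine (Real.rpow_le_rpow (hpos t).le h4 hα.le).trans (le_of_eq ?_)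
      rw [Real.mul_rpow hH0 (Real.exp_pos _).le, ← Real.exp_mul]
    calc κ * (w t) ^ (6 / a) * w t ≤ κ * (H ^ (6 / a) * Real.exp (-(σ * t) * (6 / a))) *
          (H * Real.exp (-(σ * t))) := by
          have := (hpos t).le
          gcongr
      _ = κ * H ^ (6 / a) * H * (Real.exp (-(σ * t) * (6 / a)) * Real.exp (-(σ * t))) := by ring
      _ = _ := by
        rw [← Real.exp_add]
        congr 2
        rw [← hσq]; ring
  obtain ⟨C, H1, -, -, hz⟩ := lim_bd hc0 (by linarith) hT h.sys.hz h.sys.hr hM.hz hM.hr hg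
  obtain ⟨B, H2, -, -, hu⟩ := lim_bd hb0 (by linarith) hT h.sys.hu h.sys.hq hM.hu hM.hq hz
  obtain ⟨A, H3, hA, -, hw⟩ := lim_bd ha (by linarith) hT h.sys.hw h.sys.hp hM.hw hM.hp hu
  refine ⟨A, ?_, hA, T, H3, hT, ?_, fun t ht => (le_abs_self _).trans (hw t ht)⟩
  · have h1 := le_lim_of_mono (T := 0) (aux_hd2 (l := a) h.sys.hw) hA (fun t _ =>
      mul_nonneg (Real.exp_pos _).le (h.signs hf ha hb0 hc0 hpos t).2.2) 0 le_rfl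
    have h2 := mul_pos (Real.exp_pos (a * 0)) (hpos 0)
    linarith
  · have := (abs_nonneg _).trans (hw T le_rfl)
    exact nonneg_of_mul_nonneg_left this (Real.exp_pos _)

/-! ### Uniqueness of homoclinics with given leading coefficient -/

lemma cone_end {a b c M : ℝ} {w p u q z r g : ℝ → ℝ} (ha : 0 < a) (hb : 0 < b) (hc : 0 < c)
    (h : Sys6 a b c w p u q z r g) (hbd : Bd6 M w p u q z r)
    (hg : ∀ t, 0 ≤ w t → 0 ≤ g t) (hg' : ∀ t, w t ≤ 0 → g t ≤ 0) {T : ℝ}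
    (w1 : 0 < w T) (p1 : p T ≤ 0) (u1 : 0 ≤ u T) (q1 : q T ≤ 0)
    (zr : (0 ≤ z T ∧ r T ≤ 0) ∨ (z T ≤ 0 ∧ 0 ≤ r T)) : False := by
  have h' := h.refl 0
  obtain ⟨δ, hδ, hp⟩ := posright (t0 := -T) h'.hw (cont_of_hd h'.hp)
    (Or.inl (by simpa using w1))
  have e : (0 : ℝ) - -T = T := by ring
  refine grow6 ha hb hc h' (hbd.refl 0) (fun t => hg _) (fun t => hg' _) hδ hp
    ?_ ?_ ?_ ?_ ?_
  · rw [e]; exact w1.le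
  · rw [e]; linarith
  · rw [e]; exact u1
  · rw [e]; linarith
  · rw [e]
    rcases zr with zr | zr
    · left; exact ⟨zr.1, by linarith [zr.2]⟩
    · right; exact ⟨zr.1, by linarith [zr.2]⟩

lemma ev_of_lim {f : ℝ → ℝ} {l L : ℝ} (h : Tendsto (fun t => Real.exp (l * t) * f t) atTop (𝓝 L))
    (hL : 0 < L) : ∃ T, ∀ t, T ≤ t → 0 < f t := by
  obtain ⟨T, hT⟩ := eventually_atTop.1 (h.eventually (lt_mem_nhds hL))
  exact ⟨T, fun t ht => pos_of_mul_pos_right (hT t ht) (Real.exp_pos _).le⟩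

lemma ev_of_lim' {f : ℝ → ℝ} {l L : ℝ} (h : Tendsto (fun t => Real.exp (l * t) * f t) atTop (𝓝 L))
    (hL : L < 0) : ∃ T, ∀ t, T ≤ t → f t < 0 := by
  obtain ⟨T, hT⟩ := ev_of_lim (f := fun t => -f t) (l := l) (L := -L)
    (h.neg.congr (fun t => by ring)) (by linarith)
  exact ⟨T, fun t ht => by have := hT t ht; linarith⟩

lemma caseB {a b c M C T : ℝ} {w p u q z r g : ℝ → ℝ} (ha : 0 < a) (hb : 0 < b) (hc : 0 < c)
    (h : Sys6 a b c w p u q z r g) (hbd : Bd6 M w p u q z r)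
    (hg : ∀ t, 0 ≤ w t → 0 ≤ g t) (hg' : ∀ t, w t ≤ 0 → g t ≤ 0)
    (hw : Tendsto (fun t => Real.exp (a * t) * w t) atTop (𝓝 0))
    (hz : Tendsto (fun t => Real.exp (c * t) * z t) atTop (𝓝 C))
    (hr : Tendsto (fun t => Real.exp (c * t) * r t) atTop (𝓝 (-(c * C))))
    (hu : ∀ t, T ≤ t → 0 < u t ∧ q t < 0) : False := by
  have h1 := decS_strict ha h.hw h.hp hbd.hw hbd.hp (fun t ht => (hu t ht).1)
  have h2 := posS h.hw hw h1
  have h3 : ∀ t, T ≤ t → p t ≤ 0 := fun t ht => by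
    have := mul_pos ha (h2 t ht)
    linarith [h1 t ht]
  rcases lt_or_ge 0 C with hC | hC
  · obtain ⟨T1, hT1⟩ := ev_of_lim hz hC
    obtain ⟨T2, hT2⟩ := ev_of_lim' hr (by have := mul_pos hc hC; linarith)
    set S := max T (max T1 T2)
    have s1 : T ≤ S := le_max_left _ _
    have s2 : T1 ≤ S := (le_max_left _ _).trans (le_max_right _ _)
    have s3 : T2 ≤ S := (le_max_right _ _).trans (le_max_right _ _)
    exact cone_end ha hb hc h hbd hg hg' (h2 S s1) (h3 S s1) (hu S s1).1.le (hu S s1).2.le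
      (Or.inl ⟨(hT1 S s2).le, (hT2 S s3).le⟩)
  · have h4 := decS (f := fun t => -z t) (p := fun t => -r t) (h := fun t => g t) (M := M) (T := T)
      hc (fun t => (h.hz t).neg) (fun t => (h.hr t).neg.congr_deriv (by ring))
      (fun t => by simpa using hbd.hz t) (fun t => by simpa using hbd.hr t)
      (fun t ht => hg t (h2 t ht).le)
    have h5 := le_lim_of_mono (T := T) (aux_hd2 (l := c) h.hz) hz (fun t ht =>
      mul_nonneg (Real.exp_pos _).le (by linarith [h4 t ht.le])) T le_rfl
    have h6 : z T ≤ 0 := by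
      by_contra hcon
      push Not at hcon
      have := mul_pos (Real.exp_pos (c * T)) hcon
      linarith
    have h7 : 0 ≤ r T := by
      have := mul_nonneg hc.le (show 0 ≤ -z T by linarith)
      linarith [h4 T le_rfl]
    exact cone_end ha hb hc h hbd hg hg' (h2 T le_rfl) (h3 T le_rfl) (hu T le_rfl).1.le
      (hu T le_rfl).2.le (Or.inr ⟨h6, h7⟩)

lemma caseBC {a b c M B C : ℝ} {w p u q z r g : ℝ → ℝ} (ha : 0 < a) (hb : 0 < b) (hc : 0 < c)
    (h : Sys6 a b c w p u q z r g) (hbd : Bd6 M w p u q z r)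
    (hg : ∀ t, 0 ≤ w t → 0 ≤ g t) (hg' : ∀ t, w t ≤ 0 → g t ≤ 0)
    (hw : Tendsto (fun t => Real.exp (a * t) * w t) atTop (𝓝 0))
    (hu : Tendsto (fun t => Real.exp (b * t) * u t) atTop (𝓝 B))
    (hq : Tendsto (fun t => Real.exp (b * t) * q t) atTop (𝓝 (-(b * B))))
    (hz : Tendsto (fun t => Real.exp (c * t) * z t) atTop (𝓝 C))
    (hr : Tendsto (fun t => Real.exp (c * t) * r t) atTop (𝓝 (-(c * C)))) :
    ¬ (0 < B ∨ (B = 0 ∧ 0 < C)) := by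
  rintro (hB | ⟨hB, hC⟩)
  · obtain ⟨T1, hT1⟩ := ev_of_lim hu hB
    obtain ⟨T2, hT2⟩ := ev_of_lim' hq (by have := mul_pos hb hB; linarith)
    exact caseB (T := max T1 T2) ha hb hc h hbd hg hg' hw hz hr (fun t ht =>
      ⟨hT1 t ((le_max_left _ _).trans ht), hT2 t ((le_max_right _ _).trans ht)⟩)
  · obtain ⟨T1, hT1⟩ := ev_of_lim hz hC
    have h1 := decS_strict hb h.hu h.hq hbd.hu hbd.hq hT1
    rw [hB] at hu
    have h2 := posS h.hu hu h1
    exact caseB (T := T1) ha hb hc h hbd hg hg' hw hz hr (fun t ht => ⟨h2 t ht, by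
      have := mul_pos hb (h2 t ht)
      linarith [h1 t ht]⟩)

lemma expo_le {l q t K : ℝ} {x : ℝ} (h : |Real.exp (l * t) * x - 0| ≤ K * Real.exp (-((q - l) * t))) :
    |x| ≤ K * Real.exp (-(q * t)) := by
  rw [sub_zero, abs_mul, abs_of_pos (Real.exp_pos _)] at h
  have h2 : Real.exp (-((q - l) * t)) = Real.exp (l * t) * Real.exp (-(q * t)) := by
    rw [← Real.exp_add]; congr 1; ring
  rw [h2] at h
  refine le_of_mul_le_mul_left ?_ (Real.exp_pos (l * t))
  linarith

lemma Sys6.contract {a b c M κ T W : ℝ} {w p u q z r g : ℝ → ℝ} (ha : 0 < a) (hb : b = a + 2)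
    (hc : c = a + 4) (h : Sys6 a b c w p u q z r g) (hbd : Bd6 M w p u q z r) 
    (hκT : κ * Real.exp (-T) ≤ 1 / 2) (hκ : 0 ≤ κ) (hT0 : 0 ≤ T)
    (hgw : ∀ t, T ≤ t → |g t| ≤ κ * Real.exp (-(6 * t)) * |w t|)
    (hw : Tendsto (fun t => Real.exp (a * t) * w t) atTop (𝓝 0))
    (hu : Tendsto (fun t => Real.exp (b * t) * u t) atTop (𝓝 0))
    (hz : Tendsto (fun t => Real.exp (c * t) * z t) atTop (𝓝 0))
    (hW : ∀ t, T ≤ t → |w t| ≤ W * Real.exp (-(a * t))) : 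
    ∀ t, T ≤ t → |w t| ≤ W / 2 * Real.exp (-(a * t)) ∧ 
      (W = 0 → w t = 0 ∧ p t = 0 ∧ u t = 0 ∧ q t = 0 ∧ z t = 0 ∧ r t = 0) := by
  have hW0 : 0 ≤ W := nonneg_of_mul_nonneg_left ((abs_nonneg _).trans (hW T le_rfl)) (Real.exp_pos _)
  have hg : ∀ t, T ≤ t → |-g t| ≤ W / 2 * Real.exp (-((a + 5) * t)) := by
    intro t ht
    rw [abs_neg]
    have h6 : Real.exp (-(6 * t)) ≤ Real.exp (-T) * Real.exp (-(5 * t)) := by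
      rw [← Real.exp_add, Real.exp_le_exp]; linarith
    have h7 : Real.exp (-((a + 5) * t)) = Real.exp (-(5 * t)) * Real.exp (-(a * t)) := by
      rw [← Real.exp_add]; congr 1; ring
    calc |g t| ≤ κ * Real.exp (-(6 * t)) * |w t| := hgw t ht
      _ ≤ κ * (Real.exp (-T) * Real.exp (-(5 * t))) * (W * Real.exp (-(a * t))) := by
        gcongr
        exact hW t ht
      _ = (κ * Real.exp (-T)) * (W * (Real.exp (-(5 * t)) * Real.exp (-(a * t)))) := by ring
      _ ≤ 1 / 2 * (W * (Real.exp (-(5 * t)) * Real.exp (-(a * t)))) := by gcongr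
      _ = _ := by rw [h7]; ring
  have hb0 : 0 < b := by linarith
  have hc0 : 0 < c := by linarith
  obtain ⟨C, l1, e1⟩ := lim_lemma hc0 (by linarith : c < a + 5) h.hz h.hr hbd.hz hbd.hr hg
  have hC := tendsto_nhds_unique l1 hz
  subst hC
  have z1 : ∀ t, T ≤ t → |z t| ≤ W / 2 / (a + 5 + c) / (a + 5 - c) * Real.exp (-((a + 5) * t)) :=
    fun t ht => expo_le (e1 t ht).1
  obtain ⟨B, l2, e2⟩ := lim_lemma hb0 (by linarith : b < a + 5) h.hu h.hq hbd.hu hbd.hq z1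
  have hB := tendsto_nhds_unique l2 hu
  subst hB
  have u1 : ∀ t, T ≤ t → |u t| ≤ W / 2 / (a + 5 + c) / (a + 5 - c) / (a + 5 + b) / (a + 5 - b) *
      Real.exp (-((a + 5) * t)) :=
    fun t ht => expo_le (e2 t ht).1
  obtain ⟨A, l3, e3⟩ := lim_lemma ha (by linarith : a < a + 5) h.hw h.hp hbd.hw hbd.hp u1
  have hA := tendsto_nhds_unique l3 hw
  subst hA
  have w1 : ∀ t, T ≤ t → |w t| ≤ W / 2 / (a + 5 + c) / (a + 5 - c) / (a + 5 + b) / (a + 5 - b) 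
      / (a + 5 + a) / (a + 5 - a) * Real.exp (-((a + 5) * t)) :=
    fun t ht => expo_le (e3 t ht).1
  intro t ht
  constructor
  · refine (w1 t ht).trans ?_
    have dd : ∀ x y : ℝ, 0 ≤ x → 1 ≤ y → 0 ≤ x / y ∧ x / y ≤ x := fun x y hx hy =>
      ⟨by positivity, div_le_self hx hy⟩
    have i1 := dd (W / 2) (a + 5 + c) (by positivity) (by linarith)
    have i2 := dd _ (a + 5 - c) i1.1 (by linarith)
    have i3 := dd _ (a + 5 + b) i2.1 (by linarith)
    have i4 := dd _ (a + 5 - b) i3.1 (by linarith)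
    have i5 := dd _ (a + 5 + a) i4.1 (by linarith)
    have i6 := dd _ (a + 5 - a) i5.1 (by linarith)
    have i7 : Real.exp (-((a + 5) * t)) ≤ Real.exp (-(a * t)) := by
      rw [Real.exp_le_exp]; nlinarith
    exact mul_le_mul (by linarith) i7 (Real.exp_pos _).le (by positivity)
  · rintro rfl
    have z2 := z1 t ht
    have u2 := u1 t ht
    have w2 := w1 t ht
    have r2 := (e1 t ht).2
    have q2 := (e2 t ht).2
    have p2 := (e3 t ht).2
    simp only [zero_div, zero_mul, abs_nonpos_iff] at z2 u2 w2 r2 q2 p2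
    rw [z2, mul_zero, add_zero] at r2
    rw [u2, mul_zero, add_zero] at q2
    rw [w2, mul_zero, add_zero] at p2
    exact ⟨w2, p2, u2, q2, z2, r2⟩

lemma Sol.homo_unique {a b c k e κ A : ℝ} {f w p u q z r w' p' u' q' z' r' : ℝ → ℝ} (hf : NL k e f)
    (hgr : Gr κ (6 / a) f) (hκ : 0 ≤ κ)
    (ha : 0 < a) (hb : b = a + 2) (hc : c = a + 4)
    (h : Sol a b c f w p u q z r) (hpos : ∀ t, 0 < w t) 
    (h' : Sol a b c f w' p' u' q' z' r') (hpos' : ∀ t, 0 < w' t) 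
    (hl : Tendsto (fun t => Real.exp (a * t) * w t) atTop (𝓝 A))
    (hl' : Tendsto (fun t => Real.exp (a * t) * w' t) atTop (𝓝 A))
    (hH : ∃ T H, 0 ≤ T ∧ 0 ≤ H ∧ ∀ t, T ≤ t → w t ≤ H * Real.exp (-(a * t)))
    (hH' : ∃ T H, 0 ≤ T ∧ 0 ≤ H ∧ ∀ t, T ≤ t → w' t ≤ H * Real.exp (-(a * t))) :
    ∀ t, w t = w' t := by
  have hb0 : 0 < b := by linarith
  have hc0 : 0 < c := by linarith
  obtain ⟨T1, H1, hT1, hH1, hw1⟩ := hH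
  obtain ⟨T2, H2, hT2, hH2, hw2⟩ := hH'
  obtain ⟨M1, hM1⟩ := h.bd
  obtain ⟨M2, hM2⟩ := h'.bd
  have hs := h.sys.sub h'.sys
  have hbd := hM1.sub hM2
  set H := max H1 H2 with hHdef
  have hH0 : 0 ≤ H := hH1.trans (le_max_left _ _)
  set κ' := κ * H ^ (6 / a) with hκ'
  have hκ'0 : 0 ≤ κ' := by positivity
  set T0 := max T1 T2 with hT0
  have hT00 : 0 ≤ T0 := hT1.trans (le_max_left _ _)
  have sg : ∀ t, 0 ≤ w t - w' t → 0 ≤ f (w t) - f (w' t) := fun t ht => by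
    have := hf.mono.monotone (show w' t ≤ w t by linarith); linarith
  have sg' : ∀ t, w t - w' t ≤ 0 → f (w t) - f (w' t) ≤ 0 := fun t ht => by
    have := hf.mono.monotone (show w t ≤ w' t by linarith); linarith
  have lw : Tendsto (fun t => Real.exp (a * t) * (w t - w' t)) atTop (𝓝 0) := by
    have := hl.sub hl'
    rw [sub_self] at this
    exact this.congr (fun t => by ring)
  have b1 : ∀ t, T0 ≤ t → w t ≤ H * Real.exp (-(a * t)) := fun t ht =>
    (hw1 t ((le_max_left _ _).trans ht)).trans
      (mul_le_mul_of_nonneg_right (le_max_left _ _) (Real.exp_pos _).le)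
  have b2 : ∀ t, T0 ≤ t → w' t ≤ H * Real.exp (-(a * t)) := fun t ht =>
    (hw2 t ((le_max_right _ _).trans ht)).trans
      (mul_le_mul_of_nonneg_right (le_max_right _ _) (Real.exp_pos _).le)
  have bw : ∀ t, T0 ≤ t → |w t - w' t| ≤ H * Real.exp (-(a * t)) := fun t ht => by
    rw [abs_le]
    constructor
    · linarith [b2 t ht, hpos t]
    · linarith [b1 t ht, hpos' t]
  have bg : ∀ t, T0 ≤ t → |f (w t) - f (w' t)| ≤ κ' * Real.exp (-(6 * t)) * |w t - w' t| := by
    intro t ht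
    refine (hgr _ _).trans ?_
    refine mul_le_mul_of_nonneg_right ?_ (abs_nonneg _)
    rw [hκ', mul_assoc]
    refine mul_le_mul_of_nonneg_left ?_ hκ
    rw [abs_of_pos (hpos t), abs_of_pos (hpos' t)]
    refine (Real.rpow_le_rpow ((hpos t).le.trans (le_max_left _ _)) (max_le (b1 t ht) (b2 t ht))
      (by positivity)).trans (le_of_eq ?_)
    rw [Real.mul_rpow hH0 (Real.exp_pos _).le, ← Real.exp_mul]
    congr 2
    field_simp
  have bgn : ∀ t, T0 ≤ t → |-(f (w t) - f (w' t))| ≤ κ' * H * Real.exp (-((a + 6) * t)) := by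
    intro t ht
    rw [abs_neg]
    refine (bg t ht).trans ?_
    have h7 : Real.exp (-((a + 6) * t)) = Real.exp (-(6 * t)) * Real.exp (-(a * t)) := by
      rw [← Real.exp_add]; congr 1; ring
    calc κ' * Real.exp (-(6 * t)) * |w t - w' t| 
        ≤ κ' * Real.exp (-(6 * t)) * (H * Real.exp (-(a * t))) := by
          gcongr; exact bw t ht
      _ = _ := by rw [h7]; ring
  obtain ⟨C, H3, lz, lr, bz⟩ := lim_bd hc0 (by linarith : c < a + 6) hT00 hs.hz hs.hr hbd.hz hbd.hr bgn
  obtain ⟨B, H4, lu, lq, bu⟩ := lim_bd hb0 (by linarith : b < c) hT00 hs.hu hs.hq hbd.hu hbd.hq bz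
  have P := caseBC ha hb0 hc0 hs hbd sg sg' lw lu lq lz lr
  have hn := hs.neg
  have N := caseBC (B := -B) (C := -C) ha hb0 hc0 hn hbd.neg 
    (fun t ht => by have := sg' t (by linarith); linarith)
    (fun t ht => by have := sg t (by linarith); linarith)
    ((lw.neg.congr (fun t => by ring)).trans (le_of_eq (by simp)))
    (lu.neg.congr (fun t => by ring))
    ((lq.neg.congr (fun t => by ring)).trans (le_of_eq (by congr 1; ring)))
    (lz.neg.congr (fun t => by ring))
    ((lr.neg.congr (fun t => by ring)).trans (le_of_eq (by congr 1; ring)))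
  have hB : B = 0 := by
    rcases lt_trichotomy B 0 with h0 | h0 | h0
    · exact (N (Or.inl (by linarith))).elim
    · exact h0
    · exact (P (Or.inl h0)).elim
  have hC : C = 0 := by
    rcases lt_trichotomy C 0 with h0 | h0 | h0
    · exact (N (Or.inr ⟨by linarith, by linarith⟩)).elim
    · exact h0
    · exact (P (Or.inr ⟨hB, h0⟩)).elim
  rw [hB] at lu
  rw [hC] at lz
  have hev : ∀ᶠ T in atTop, κ' * Real.exp (-T) < 1 / 2 := by
    have := Real.tendsto_exp_neg_atTop_nhds_zero.const_mul κ'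
    rw [mul_zero] at this
    exact this.eventually (gt_mem_nhds (by norm_num))
  obtain ⟨T, hT, hTT⟩ := (hev.and (eventually_ge_atTop T0)).exists
  have step : ∀ W, (∀ t, T ≤ t → |w t - w' t| ≤ W * Real.exp (-(a * t))) → _ := fun W hW =>
    hs.contract ha hb hc hbd hT.le hκ'0 (hT00.trans hTT) (fun t ht => bg t (hTT.trans ht))
      lw lu lz hW
  have iter : ∀ n : ℕ, ∀ t, T ≤ t → |w t - w' t| ≤ H / 2 ^ n * Real.exp (-(a * t)) := by
    intro n
    induction n with
    | zero => intro t ht; simpa using bw t (hTT.trans ht)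
    | succ n ih =>
      intro t ht
      have := (step _ ih t ht).1
      refine this.trans (le_of_eq ?_)
      rw [pow_succ]; ring
  have hzero : ∀ t, T ≤ t → |w t - w' t| ≤ 0 * Real.exp (-(a * t)) := by
    intro t ht
    have h1 : Tendsto (fun n : ℕ => H / 2 ^ n * Real.exp (-(a * t))) atTop (𝓝 (0 * Real.exp (-(a * t)))) := by
      refine Tendsto.mul_const _ ?_
      have h2 := (tendsto_pow_atTop_nhds_zero_of_lt_one (r := (1 / 2 : ℝ)) (by norm_num)
        (by norm_num)).const_mul H
      rw [mul_zero] at h2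
      refine h2.congr (fun n => ?_)
      rw [div_pow, one_pow]; ring
    exact ge_of_tendsto' h1 (fun n => iter n t ht)
  obtain ⟨e1, e2, e3, e4, e5, e6⟩ := (step 0 hzero T le_rfl).2 rfl
  exact h.unique hf h' (t0 := T) (by linarith) (by linarith) (by linarith) (by linarith)
    (by linarith) (by linarith)

/-- The power nonlinearity. -/
noncomputable def fpow (C α : ℝ) (x : ℝ) : ℝ := C * |x| ^ α * x

lemma fpow_odd (C α x : ℝ) : fpow C α (-x) = -fpow C α x := by
  simp [fpow]

lemma fpow_pos {C α x : ℝ} (hx : 0 < x) : fpow C α x = C * x ^ (α + 1) := by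
  unfold fpow
  rw [abs_of_pos hx, Real.rpow_add_one hx.ne']
  ring

lemma fpow_cont {C α : ℝ} (hα : 0 < α) : Continuous (fpow C α) := by
  unfold fpow
  exact (continuous_const.mul (continuous_abs.rpow_const (fun x => Or.inr hα.le))).mul continuous_id

lemma fpow_mono {C α : ℝ} (hC : 0 < C) (hα : 0 < α) : StrictMono (fpow C α) := by
  apply strictMono_of_odd_strictMonoOn_nonneg (fpow_odd C α)
  intro x hx y hy hxy
  have hx : 0 ≤ x := hx
  have hy0 : 0 < y := lt_of_le_of_lt hx hxy
  rcases hx.eq_or_lt with h | h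
  · subst h
    rw [fpow_pos hy0]
    simp only [fpow, mul_zero]
    positivity
  · rw [fpow_pos h, fpow_pos hy0]
    have := Real.rpow_lt_rpow h.le hxy (by linarith : 0 < α + 1)
    nlinarith

lemma fpow_hd {C α : ℝ} (hα : 0 < α) (x : ℝ) :
    HasDerivAt (fpow C α) (C * (α + 1) * |x| ^ α) x := by
  have hpos : ∀ x : ℝ, 0 < x → HasDerivAt (fpow C α) (C * (α + 1) * |x| ^ α) x := by
    intro x hx
    have h1 : HasDerivAt (fun y : ℝ => C * y ^ (α + 1)) (C * ((α + 1) * x ^ (α + 1 - 1))) x :=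
      (Real.hasDerivAt_rpow_const (Or.inl hx.ne')).const_mul C
    have h2 : fpow C α =ᶠ[𝓝 x] fun y : ℝ => C * y ^ (α + 1) := by
      filter_upwards [lt_mem_nhds hx] with y hy using fpow_pos hy
    refine (h1.congr_of_eventuallyEq h2).congr_deriv ?_
    rw [abs_of_pos hx, add_sub_cancel_right]
    ring
  have hne : ∀ y : ℝ, y ≠ 0 → HasDerivAt (fpow C α) (C * (α + 1) * |y| ^ α) y := by
    intro y hy
    rcases lt_or_gt_of_ne hy with h | h
    · have h1 := hpos (-y) (by linarith)
      have h2 := (HasDerivAt.comp y h1 (hasDerivAt_neg y)).neg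
      have h3 : (-(fpow C α ∘ Neg.neg)) = fpow C α := by
        funext s
        simp [fpow_odd]
      rw [h3] at h2
      exact h2.congr_deriv (by rw [abs_neg]; ring)
    · exact hpos y h
  by_cases hx : x = 0
  · subst hx
    refine hasDerivAt_of_hasDerivAt_of_ne hne (fpow_cont hα).continuousAt ?_
    exact (continuous_const.mul (continuous_abs.rpow_const (fun x => Or.inr hα.le))).continuousAt
  · exact hne x hx

lemma fpow_gr {C α : ℝ} (hC : 0 < C) (hα : 0 < α) : Gr (C * (α + 1)) α (fpow C α) := by
  intro x y
  have hconv : Convex ℝ (Set.uIcc x y) := convex_uIcc x y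
  have := hconv.norm_image_sub_le_of_norm_hasDerivWithin_le (f := fpow C α)
    (f' := fun s => C * (α + 1) * |s| ^ α) (C := C * (α + 1) * (max |x| |y|) ^ α)
    (x := y) (y := x)
    (fun s _ => (fpow_hd hα s).hasDerivWithinAt) (by
      intro s hs
      rw [Real.norm_eq_abs, abs_of_nonneg (by positivity)]
      have : |s| ≤ max |x| |y| := by
        rw [Set.mem_uIcc] at hs
        rcases hs with h | h
        · exact abs_le_max_abs_abs h.1 h.2
        · rw [max_comm]; exact abs_le_max_abs_abs h.1 h.2
      gcongr) Set.right_mem_uIcc Set.left_mem_uIcc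
  simpa [Real.norm_eq_abs] using this

lemma fpow_NL {C α K e : ℝ} (hC : 0 < C) (hα : 0 < α) (he : 0 < e) (hK : K = C * e ^ α) :
    NL K e (fpow C α) where
  odd := fpow_odd C α
  mono := fpow_mono hC hα
  lip := by
    intro M
    refine ⟨C * (α + 1) * M ^ α, fun x y hx hy => (fpow_gr hC hα x y).trans ?_⟩
    have : max |x| |y| ≤ M := max_le hx hy
    have h0 : 0 ≤ max |x| |y| := le_max_of_le_left (abs_nonneg x)
    gcongr
  epos := he
  below := by
    intro x hx hxe
    unfold fpow
    rw [abs_of_pos hx, hK]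
    have := Real.rpow_lt_rpow hx.le hxe hα
    gcongr
  above := by
    intro x hx
    unfold fpow
    rw [abs_of_pos (he.trans hx), hK]
    have := Real.rpow_lt_rpow he.le hx hα
    have := he.trans hx
    gcongr
  cont := fpow_cont hα
  eqe := by
    unfold fpow
    rw [abs_of_pos he, hK]

/-- second derivative building blocks of powers of cosh -/
lemma cosh_hd (τ m t : ℝ) : HasDerivAt (fun t => Real.cosh (t - τ) ^ (-m))
    (-m * Real.sinh (t - τ) * Real.cosh (t - τ) ^ (-m - 1)) t := by
  have h0 : HasDerivAt (fun t : ℝ => t - τ) 1 t := (hasDerivAt_id t).sub_const τ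
  have h1 := h0.cosh.rpow_const (p := -m) (Or.inl (Real.cosh_pos _).ne')
  exact h1.congr_deriv (by ring)

lemma cosh_hd2 (τ m t : ℝ) :
    HasDerivAt (fun t => -m * Real.sinh (t - τ) * Real.cosh (t - τ) ^ (-m - 1))
    (m ^ 2 * Real.cosh (t - τ) ^ (-m) - m * (m + 1) * Real.cosh (t - τ) ^ (-(m + 2))) t := by
  have h0 : HasDerivAt (fun t : ℝ => t - τ) 1 t := (hasDerivAt_id t).sub_const τ
  have hc : 0 < Real.cosh (t - τ) := Real.cosh_pos _
  have h1 := h0.cosh.rpow_const (p := -m - 1) (Or.inl hc.ne')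
  have h2 := (h0.sinh.const_mul (-m)).mul h1
  refine h2.congr_deriv ?_
  have e1 : Real.cosh (t - τ) ^ (-m) = Real.cosh (t - τ) ^ (-(m + 2)) * Real.cosh (t - τ) ^ 2 := by
    rw [← Real.rpow_add_natCast hc.ne']
    congr 1
    push_cast
    ring
  have e2 : Real.cosh (t - τ) ^ (-m - 1) = Real.cosh (t - τ) ^ (-(m + 2)) * Real.cosh (t - τ) := by
    rw [← Real.rpow_add_one hc.ne']
    congr 1
    ring
  have e3 : Real.cosh (t - τ) ^ (-m - 1 - 1) = Real.cosh (t - τ) ^ (-(m + 2)) := by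
    congr 1
    ring
  rw [e3, e2, e1]
  have := Real.cosh_sq (t - τ)
  linear_combination (-(m * (m+1) * Real.cosh (t - τ) ^ (-(m + 2)))) * this

lemma cosh_bd {m : ℝ} (hm : 0 < m) (s : ℝ) : |Real.cosh s ^ (-m)| ≤ 1 := by
  rw [abs_of_pos (Real.rpow_pos_of_pos (Real.cosh_pos _) _)]
  exact Real.rpow_le_one_of_one_le_of_nonpos (Real.one_le_cosh s) (by linarith)

lemma abs_sinh_le (s : ℝ) : |Real.sinh s| ≤ Real.cosh s := by
  have := Real.cosh_sq s
  exact abs_le_of_sq_le_sq (by linarith) (Real.cosh_pos s).le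

lemma cosh_bd2 {m : ℝ} (hm : 0 < m) (s : ℝ) : |-m * Real.sinh s * Real.cosh s ^ (-m - 1)| ≤ m := by
  have hc := Real.cosh_pos s
  have h1 := cosh_bd hm s
  have e2 : Real.cosh s ^ (-m) = Real.cosh s ^ (-m - 1) * Real.cosh s := by
    rw [← Real.rpow_add_one hc.ne']
    congr 1
    ring
  rw [e2, abs_mul, abs_of_pos hc] at h1
  rw [abs_mul, abs_mul, abs_neg, abs_of_pos hm]
  have := abs_sinh_le s
  have h3 := abs_nonneg (Real.cosh s ^ (-m - 1))
  calc m * |Real.sinh s| * |Real.cosh s ^ (-m - 1)| ≤ m * Real.cosh s * |Real.cosh s ^ (-m - 1)| := by gcongr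
    _ = m * (|Real.cosh s ^ (-m - 1)| * Real.cosh s) := by ring
    _ ≤ m * 1 := by gcongr
    _ = m := by ring

lemma cosh_Sol {a C : ℝ} (τ : ℝ) (ha : 0 < a) (hC : C = a*(a+1)*(a+2)*(a+3)*(a+4)*(a+5)) :
    ∃ p u q z r, Sol a (a+2) (a+4) (fpow C (6/a)) (fun t => Real.cosh (t - τ) ^ (-a)) p u q z r := by
  set P : ℝ → ℝ → ℝ := fun m t => -m * Real.sinh (t - τ) * Real.cosh (t - τ) ^ (-m - 1) with hP
  set k1 : ℝ := -(a*(a+1)) with hk1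
  set k2 : ℝ := a*(a+1)*(a+2)*(a+3) with hk2
  refine ⟨P a, fun t => k1 * Real.cosh (t - τ) ^ (-(a+2)), fun t => k1 * P (a+2) t,
    fun t => k2 * Real.cosh (t - τ) ^ (-(a+4)), fun t => k2 * P (a+4) t, ⟨?_, ?_, ?_, ?_, ?_, ?_⟩, ?_⟩
  · exact fun t => cosh_hd τ a t
  · intro t
    exact (cosh_hd2 τ a t).congr_deriv (by simp only [hk1]; ring)
  · exact fun t => (cosh_hd τ (a+2) t).const_mul k1
  · intro t
    refine ((cosh_hd2 τ (a+2) t).const_mul k1).congr_deriv ?_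
    have : a + 2 + 2 = a + 4 := by ring
    rw [this]
    simp only [hk1, hk2]
    ring
  · exact fun t => (cosh_hd τ (a+4) t).const_mul k2
  · intro t
    refine ((cosh_hd2 τ (a+4) t).const_mul k2).congr_deriv ?_
    have hc : 0 < Real.cosh (t - τ) := Real.cosh_pos _
    have : a + 4 + 2 = a + 6 := by ring
    rw [this, fpow_pos (Real.rpow_pos_of_pos hc _), ← Real.rpow_mul hc.le]
    have : -a * (6 / a + 1) = -(a + 6) := by
      field_simp
      ring
    rw [this, hC]
    simp only [hk2]
    ring
  · have f1 : 0 < a + 2 := by linarith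
    have f2 : 0 < a + 4 := by linarith
    refine ⟨1 + a + |k1| + |k1| * (a+2) + |k2| + |k2| * (a+4), ?_⟩
    have g1 : 0 ≤ |k1| := abs_nonneg _
    have g2 : 0 ≤ |k2| := abs_nonneg _
    have g3 : 0 ≤ |k1| * (a+2) := by positivity
    have g4 : 0 ≤ |k2| * (a+4) := by positivity
    have A : ∀ k m t : ℝ, 0 < m → |k * Real.cosh (t - τ) ^ (-m)| ≤ |k| := by
      intro k m t hm
      rw [abs_mul]
      exact mul_le_of_le_one_right (abs_nonneg _) (cosh_bd hm _)
    have B : ∀ k m t : ℝ, 0 < m → |k * P m t| ≤ |k| * m := by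
      intro k m t hm
      rw [abs_mul]
      exact mul_le_mul_of_nonneg_left (cosh_bd2 hm _) (abs_nonneg _)
    refine ⟨fun t => ?_, fun t => ?_, fun t => ?_, fun t => ?_, fun t => ?_, fun t => ?_⟩
    · linarith [cosh_bd ha (t - τ)]
    · have := cosh_bd2 ha (t - τ)
      simp only [hP]
      linarith
    · linarith [A k1 _ t f1]
    · linarith [B k1 _ t f1]
    · linarith [A k2 _ t f2]
    · linarith [B k2 _ t f2]

lemma cosh_lim {a : ℝ} (τ : ℝ) :
    Tendsto (fun t => Real.exp (a * t) * Real.cosh (t - τ) ^ (-a)) atTop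
      (𝓝 (Real.exp (a * τ) * 2 ^ a)) := by
  have h1 : ∀ t, Real.exp (a * t) * Real.cosh (t - τ) ^ (-a)
      = Real.exp (a * τ) * ((1 + Real.exp (-(2 * t)) * Real.exp (2 * τ)) / 2) ^ (-a) := by
    intro t
    have e1 : Real.cosh (t - τ) =
        Real.exp (t - τ) * ((1 + Real.exp (-(2 * t)) * Real.exp (2 * τ)) / 2) := by
      rw [Real.cosh_eq, mul_div_assoc', mul_add, ← Real.exp_add, ← Real.exp_add]
      congr 3
      · ring
      · ring_nf
    rw [e1, Real.mul_rpow (Real.exp_pos _).le (by positivity), ← Real.exp_mul, ← mul_assoc,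
      ← Real.exp_add]
    congr 2
    ring
  simp_rw [h1]
  have h2 : Tendsto (fun t : ℝ => (1 + Real.exp (-(2 * t)) * Real.exp (2 * τ)) / 2) atTop
      (𝓝 ((1 + 0 * Real.exp (2 * τ)) / 2)) :=
    (((exp_tendsto (by norm_num : (0:ℝ) < 2)).mul_const _).const_add 1).div_const 2
  have h3 := (h2.rpow_const (p := -a) (Or.inl (by norm_num))).const_mul (Real.exp (a * τ))
  convert h3 using 3
  rw [zero_mul, add_zero, one_div, Real.inv_rpow (by norm_num), Real.rpow_neg (by norm_num), inv_inv]

lemma cosh_to_zero {a : ℝ} (τ : ℝ) (ha : 0 < a) :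
    Tendsto (fun t => Real.cosh (t - τ) ^ (-a)) atTop (𝓝 0) := by
  have := (exp_tendsto ha).mul (cosh_lim (a := a) τ)
  rw [zero_mul] at this
  refine this.congr (fun t => exp_neg_cancel a t _)

/-- Positive homoclinics are the explicit ones. -/
lemma homo_explicit {a C k e : ℝ} {w p u q z r : ℝ → ℝ} (ha : 0 < a)
    (hC : C = a*(a+1)*(a+2)*(a+3)*(a+4)*(a+5)) (hf : NL k e (fpow C (6/a)))
    (h : Sol a (a+2) (a+4) (fpow C (6/a)) w p u q z r) (hpos : ∀ t, 0 < w t)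
    (hl : Tendsto w atTop (𝓝 0)) : ∃ τ, ∀ t, w t = Real.cosh (t - τ) ^ (-a) := by
  have hC0 : 0 < C := by rw [hC]; positivity
  have hα : 0 < 6 / a := by positivity
  have hgr := fpow_gr hC0 hα
  have hκ : 0 ≤ C * (6 / a + 1) := by positivity
  obtain ⟨A, hA, hlA, hH⟩ := h.asymp hf hgr hκ ha rfl rfl hpos hl
  obtain ⟨τ, hτ⟩ : ∃ τ, A = Real.exp (a * τ) * 2 ^ a := by
    refine ⟨Real.log (A / 2 ^ a) / a, ?_⟩
    rw [mul_div_cancel₀ _ ha.ne', Real.exp_log (by positivity)]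
    field_simp
  obtain ⟨p', u', q', z', r', h'⟩ := cosh_Sol τ ha hC
  have hpos' : ∀ t, 0 < Real.cosh (t - τ) ^ (-a) := fun t => Real.rpow_pos_of_pos (Real.cosh_pos _) _
  obtain ⟨A', hA', hlA', hH'⟩ := h'.asymp hf hgr hκ ha rfl rfl hpos' (cosh_to_zero τ ha)
  refine ⟨τ, h.homo_unique hf hgr hκ ha rfl rfl hpos h' hpos' hlA ?_ hH hH'⟩
  rw [hτ]
  exact cosh_lim τ

/-- Every interval contains a point where `f` is controlled. -/
def PtBd (f : ℝ → ℝ) : Prop :=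
  ∀ ℓ : ℝ, 0 < ℓ → ∃ C : ℝ, ∀ x : ℝ, ∃ ξ ∈ Set.Icc x (x + ℓ), |f ξ| ≤ C

lemma PtBd.deriv {f f' : ℝ → ℝ} (hf : PtBd f) (hd : ∀ t, HasDerivAt f (f' t) t) : PtBd f' := by
  intro ℓ hℓ
  obtain ⟨C, hC⟩ := hf (ℓ / 3) (by positivity)
  refine ⟨2 * C / (ℓ / 3), fun x => ?_⟩
  obtain ⟨s, hs, hs1⟩ := hC x
  obtain ⟨t, ht, ht1⟩ := hC (x + 2 * (ℓ / 3))
  have hst : s + ℓ / 3 ≤ t := by linarith [hs.2, ht.1]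
  have hst' : s < t := by linarith
  obtain ⟨ξ, hξ, h⟩ := exists_hasDerivAt_eq_slope f f' hst' (cont_of_hd hd).continuousOn
    (fun y _ => hd y)
  refine ⟨ξ, ⟨by linarith [hs.1, hξ.1], by linarith [ht.2, hξ.2]⟩, ?_⟩
  rw [h, abs_div, abs_of_pos (by linarith : 0 < t - s)]
  have h1 : |f t - f s| ≤ 2 * C := by
    have := abs_sub (f t) (f s)
    linarith
  have h2 : 0 ≤ 2 * C := (abs_nonneg _).trans h1
  gcongr
  linarith

lemma near_bd {f f' : ℝ → ℝ} {x ℓ C B t : ℝ} (hd : ∀ t, HasDerivAt f (f' t) t)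
    (hp : ∃ ξ ∈ Set.Icc x (x + ℓ), |f ξ| ≤ C) (hB : ∀ s ∈ Set.Icc x (x + ℓ), |f' s| ≤ B)
    (ht : t ∈ Set.Icc x (x + ℓ)) : |f t| ≤ C + ℓ * B := by
  obtain ⟨ξ, hξ, h⟩ := hp
  have h1 := (convex_Icc x (x + ℓ)).norm_image_sub_le_of_norm_hasDerivWithin_le (f := f)
    (f' := f') (C := B) (fun s _ => (hd s).hasDerivWithinAt) (fun s hs => hB s hs) hξ ht
  rw [Real.norm_eq_abs, Real.norm_eq_abs] at h1
  have h2 : |t - ξ| ≤ ℓ := by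
    rw [abs_le]
    constructor <;> linarith [hξ.1, hξ.2, ht.1, ht.2]
  have h0 : 0 ≤ B := (abs_nonneg _).trans (hB t ht)
  have h3 : B * |t - ξ| ≤ ℓ * B := by nlinarith
  have h4 := abs_sub_abs_le_abs_sub (f t) (f ξ)
  linarith

/-- Landau type bound: bounded solutions have bounded derivatives. -/
lemma landau {d0 d1 d2 d3 d4 d5 d6 : ℝ → ℝ} {M L : ℝ} (hL : 1 ≤ L)
    (h0 : ∀ t, HasDerivAt d0 (d1 t) t) (h1 : ∀ t, HasDerivAt d1 (d2 t) t)
    (h2 : ∀ t, HasDerivAt d2 (d3 t) t) (h3 : ∀ t, HasDerivAt d3 (d4 t) t)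
    (h4 : ∀ t, HasDerivAt d4 (d5 t) t) (h5 : ∀ t, HasDerivAt d5 (d6 t) t)
    (hM : ∀ t, |d0 t| ≤ M) (hd6 : ∀ t, |d6 t| ≤ L * (|d2 t| + |d4 t| + 1)) :
    ∃ N, ∀ t, |d1 t| + |d2 t| + |d3 t| + |d4 t| + |d5 t| ≤ N := by
  have p0 : PtBd d0 := fun ℓ hℓ => ⟨M, fun x => ⟨x, ⟨le_refl _, by linarith⟩, hM x⟩⟩
  have p1 := p0.deriv h0
  have p2 := p1.deriv h1
  have p3 := p2.deriv h2
  have p4 := p3.deriv h3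
  have p5 := p4.deriv h4
  obtain ⟨ℓ, hℓ, hℓL⟩ : ∃ ℓ : ℝ, 0 < ℓ ∧ ℓ * L = 1 / 10 := by
    refine ⟨1 / (10 * L), by positivity, ?_⟩
    field_simp
  obtain ⟨C1, c1⟩ := p1 ℓ hℓ
  obtain ⟨C2, c2⟩ := p2 ℓ hℓ
  obtain ⟨C3, c3⟩ := p3 ℓ hℓ
  obtain ⟨C4, c4⟩ := p4 ℓ hℓ
  obtain ⟨C5, c5⟩ := p5 ℓ hℓ
  refine ⟨2 * (C1 + C2 + C3 + C4 + C5) + 1, fun x => ?_⟩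
  have k1 := cont_of_hd h1
  have k2 := cont_of_hd h2
  have k3 := cont_of_hd h3
  have k4 := cont_of_hd h4
  have k5 := cont_of_hd h5
  have hF : Continuous (fun t => |d1 t| + |d2 t| + |d3 t| + |d4 t| + |d5 t|) :=
    (((k1.abs.add k2.abs).add k3.abs).add k4.abs).add k5.abs
  obtain ⟨t, ht, hmax⟩ := (isCompact_Icc (a := x) (b := x + ℓ)).exists_isMaxOn
    ⟨x, le_refl _, by linarith⟩ hF.continuousOn
  have hx := hmax (⟨le_refl _, by linarith⟩ : x ∈ Set.Icc x (x + ℓ))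
  simp only [Set.mem_ofPred_eq] at hx
  set Φ := |d1 t| + |d2 t| + |d3 t| + |d4 t| + |d5 t| with hΦ
  have hall : ∀ s ∈ Set.Icc x (x + ℓ), |d1 s| + |d2 s| + |d3 s| + |d4 s| + |d5 s| ≤ Φ :=
    fun s hs => hmax hs
  have hΦ0 : 0 ≤ Φ := by positivity
  have hLB : Φ ≤ L * (Φ + 1) := by nlinarith
  have bb : ∀ s ∈ Set.Icc x (x + ℓ), |d2 s| ≤ L * (Φ + 1) ∧ |d3 s| ≤ L * (Φ + 1) ∧
      |d4 s| ≤ L * (Φ + 1) ∧ |d5 s| ≤ L * (Φ + 1) ∧ |d6 s| ≤ L * (Φ + 1) := by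
    intro s hs
    have := hall s hs
    have a1 := abs_nonneg (d1 s)
    have a2 := abs_nonneg (d2 s)
    have a3 := abs_nonneg (d3 s)
    have a4 := abs_nonneg (d4 s)
    have a5 := abs_nonneg (d5 s)
    refine ⟨by linarith, by linarith, by linarith, by linarith, (hd6 s).trans ?_⟩
    gcongr
    linarith
  have e1 := near_bd h1 (c1 x) (fun s hs => (bb s hs).1) ht
  have e2 := near_bd h2 (c2 x) (fun s hs => (bb s hs).2.1) ht
  have e3 := near_bd h3 (c3 x) (fun s hs => (bb s hs).2.2.1) ht
  have e4 := near_bd h4 (c4 x) (fun s hs => (bb s hs).2.2.2.1) ht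
  have e5 := near_bd h5 (c5 x) (fun s hs => (bb s hs).2.2.2.2) ht
  have e6 : ℓ * (L * (Φ + 1)) = (Φ + 1) / 10 := by
    rw [← mul_assoc, hℓL]; ring
  rw [e6] at e1 e2 e3 e4 e5
  linarith

/-- From the scalar equation to the first order system. -/
lemma toSol {a b c K κ4 κ2 κ0 e : ℝ} {f d0 d1 d2 d3 d4 d5 d6 : ℝ → ℝ} {M : ℝ}
    (h0 : ∀ t, HasDerivAt d0 (d1 t) t) (h1 : ∀ t, HasDerivAt d1 (d2 t) t)
    (h2 : ∀ t, HasDerivAt d2 (d3 t) t) (h3 : ∀ t, HasDerivAt d3 (d4 t) t)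
    (h4 : ∀ t, HasDerivAt d4 (d5 t) t) (h5 : ∀ t, HasDerivAt d5 (d6 t) t)
    (hM : ∀ t, |d0 t| ≤ M) (hf : NL K e f)
    (hk4 : κ4 = a^2 + b^2 + c^2) (hk2 : κ2 = a^2*b^2 + b^2*c^2 + c^2*a^2)
    (hk0 : κ0 = a^2*b^2*c^2)
    (hode : ∀ t, -d6 t + κ4 * d4 t - κ2 * d2 t + κ0 * d0 t = f (d0 t)) :
    ∃ p u q z r, Sol a b c f d0 p u q z r := by
  have hM0 : 0 ≤ M := (abs_nonneg _).trans (hM 0)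
  have hfb : ∀ t, |f (d0 t)| ≤ f M := by
    intro t
    have hh := abs_le.mp (hM t)
    rw [abs_le]
    constructor
    · rw [← hf.odd]
      exact hf.mono.monotone hh.1
    · exact hf.mono.monotone hh.2
  have hfM : 0 ≤ f M := (abs_nonneg _).trans (hfb 0)
  set L : ℝ := 1 + |κ4| + |κ2| + |κ0| * M + f M with hLdef
  have q4 := abs_nonneg κ4
  have q2 := abs_nonneg κ2
  have q0 : 0 ≤ |κ0| * M := by positivity
  obtain ⟨N, hN⟩ := landau (L := L) (by linarith) h0 h1 h2 h3 h4 h5 hM (by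
    intro t
    have e : d6 t = κ4 * d4 t - κ2 * d2 t + κ0 * d0 t - f (d0 t) := by linarith [hode t]
    have e1 : |d6 t| ≤ |κ4| * |d4 t| + |κ2| * |d2 t| + |κ0| * |d0 t| + |f (d0 t)| := by
      rw [e, ← abs_mul, ← abs_mul, ← abs_mul]
      have i1 := abs_sub (κ4 * d4 t - κ2 * d2 t + κ0 * d0 t) (f (d0 t))
      have i2 := abs_add_le (κ4 * d4 t - κ2 * d2 t) (κ0 * d0 t)
      have i3 := abs_sub (κ4 * d4 t) (κ2 * d2 t)
      linarith
    have i4 := hfb t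
    have i5 : |κ0| * |d0 t| ≤ |κ0| * M := by gcongr; exact hM t
    have j4 := abs_nonneg (d4 t)
    have j2 := abs_nonneg (d2 t)
    have i6 : |κ4| * |d4 t| ≤ L * |d4 t| := by gcongr; linarith
    have i7 : |κ2| * |d2 t| ≤ L * |d2 t| := by gcongr; linarith
    have : L * (|d2 t| + |d4 t| + 1) = L * |d2 t| + L * |d4 t| + L := by ring
    rw [this]
    linarith)
  refine ⟨d1, fun t => d2 t - a^2 * d0 t, fun t => d3 t - a^2 * d1 t,
    fun t => d4 t - (a^2 + b^2) * d2 t + a^2 * b^2 * d0 t,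
    fun t => d5 t - (a^2 + b^2) * d3 t + a^2 * b^2 * d1 t, ⟨h0, ?_, ?_, ?_, ?_, ?_⟩, ?_⟩
  · exact fun t => (h1 t).congr_deriv (by ring)
  · exact fun t => (h2 t).sub ((h0 t).const_mul _)
  · exact fun t => ((h3 t).sub ((h1 t).const_mul _)).congr_deriv (by ring)
  · exact fun t => ((h4 t).sub ((h2 t).const_mul _)).add ((h0 t).const_mul _)
  · refine fun t => (((h5 t).sub ((h3 t).const_mul _)).add ((h1 t).const_mul _)).congr_deriv ?_
    have := hode t
    rw [hk4, hk2, hk0] at this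
    linear_combination -this
  · have A : ∀ {x y m k : ℝ}, |x| ≤ N + M → |y| ≤ m → 0 ≤ k → 0 ≤ m → |k * y| ≤ k * m := by
      intro x y m k _ hy hk _
      rw [abs_mul, abs_of_nonneg hk]
      gcongr
    have hb : ∀ t, |d1 t| ≤ N + M ∧ |d2 t| ≤ N + M ∧ |d3 t| ≤ N + M ∧ |d4 t| ≤ N + M ∧ |d5 t| ≤ N + M
        ∧ |d0 t| ≤ N + M := by
      intro t
      have := hN t
      have a1 := abs_nonneg (d1 t)
      have a2 := abs_nonneg (d2 t)
      have a3 := abs_nonneg (d3 t)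
      have a4 := abs_nonneg (d4 t)
      have a5 := abs_nonneg (d5 t)
      have := hM t
      refine ⟨by linarith, by linarith, by linarith, by linarith, by linarith, by linarith⟩
    have hR : 0 ≤ N + M := (abs_nonneg _).trans (hb 0).1
    set R := N + M with hRdef
    have B1 : ∀ {x y : ℝ}, |x| ≤ R → |y| ≤ R → |x - a^2 * y| ≤ R + a^2 * R := by
      intro x y hx hy
      have := abs_sub x (a^2 * y)
      have := A hx hy (sq_nonneg a) hR
      linarith
    have B2 : ∀ {x y s : ℝ}, |x| ≤ R → |y| ≤ R → |s| ≤ R →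
        |x - (a^2 + b^2) * y + a^2 * b^2 * s| ≤ R + (a^2 + b^2) * R + a^2 * b^2 * R := by
      intro x y s hx hy hs
      have := abs_add_le (x - (a^2 + b^2) * y) (a^2 * b^2 * s)
      have := abs_sub x ((a^2 + b^2) * y)
      have := A hx hy (by positivity : 0 ≤ a^2 + b^2) hR
      have := A hx hs (by positivity : 0 ≤ a^2 * b^2) hR
      linarith
    have s1 : 0 ≤ a^2 * R := by positivity
    have s2 : 0 ≤ b^2 * R := by positivity
    have s3 : 0 ≤ a^2 * b^2 * R := by positivity
    refine ⟨R + (a^2 + b^2) * R + a^2 * b^2 * R, fun t => ?_, fun t => ?_, fun t => ?_, fun t => ?_,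
      fun t => ?_, fun t => ?_⟩ <;> obtain ⟨t1, t2, t3, t4, t5, t0⟩ := hb t
    · linarith
    · linarith
    · linarith [B1 t2 t0]
    · linarith [B1 t3 t1]
    · exact B2 t4 t2 t0
    · exact B2 t5 t3 t1

end Helpers

/-- Classification of bounded entire solutions of the sixth-order Emden–Fowler ODE with
odd nonlinearity −v⁽⁶⁾ + K₄v⁽⁴⁾ − K₂v″ + K₀v = c_n|v|^(12/(n−6))v: v is one of the
constants 0, ±ε_*, a translate of ±(cosh)^((6−n)/2), or a nonconstant periodic
solution. -/
theorem classification_bounded_solutions (n : ℕ) (hn : 7 ≤ n) (v : ℝ → ℝ)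
    (hv : ContDiff ℝ 6 v) (hbd : ∃ C : ℝ, ∀ t : ℝ, |v t| ≤ C)
    (hsol : ∀ t : ℝ,
      -(iteratedDeriv 6 v t) + K4 n * iteratedDeriv 4 v t - K2 n * iteratedDeriv 2 v t
        + K0 n * v t = cst n * |v t| ^ ((12:ℝ)/((n:ℝ)-6)) * v t) :
    (∀ t, v t = 0) ∨ (∀ t, v t = epsStar n) ∨ (∀ t, v t = -(epsStar n))
    ∨ (∃ T : ℝ, (∀ t, v t = Real.cosh (t - T) ^ (((6:ℝ)-(n:ℝ))/2))
        ∨ (∀ t, v t = -(Real.cosh (t - T) ^ (((6:ℝ)-(n:ℝ))/2))))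
    ∨ ((¬ ∃ c : ℝ, ∀ t, v t = c) ∧ ∃ p : ℝ, 0 < p ∧ ∀ t, v (t + p) = v t) := by
  obtain ⟨M, hM⟩ := hbd
  have hn' : (7:ℝ) ≤ (n:ℝ) := by exact_mod_cast hn
  obtain ⟨a, haN⟩ : ∃ a : ℝ, (n:ℝ) = 2 * a + 6 := ⟨((n:ℝ) - 6) / 2, by ring⟩
  have ha : 0 < a := by linarith
  have hC : cst n = a*(a+1)*(a+2)*(a+3)*(a+4)*(a+5) := by
    unfold cst; rw [haN]; ring
  have hK0 : K0 n = a^2 * (a+2)^2 * (a+4)^2 := by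
    unfold K0; rw [haN]; ring
  have hK2 : K2 n = a^2*(a+2)^2 + (a+2)^2*(a+4)^2 + (a+4)^2*a^2 := by
    unfold K2; rw [haN]; ring
  have hK4 : K4 n = a^2 + (a+2)^2 + (a+4)^2 := by
    unfold K4; rw [haN]; ring
  have hC0 : 0 < cst n := by rw [hC]; positivity
  have hK00 : 0 < K0 n := by rw [hK0]; positivity
  have hα : 0 < 6 / a := by positivity
  have hexp : (12:ℝ) / ((n:ℝ) - 6) = 6 / a := by
    rw [haN]; field_simp; ring
  have hexp2 : ((6:ℝ) - (n:ℝ)) / 2 = -a := by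
    rw [haN]; ring
  have he : 0 < epsStar n := by unfold epsStar; positivity
  have heK : K0 n = cst n * epsStar n ^ (6 / a) := by
    unfold epsStar
    rw [← Real.rpow_mul (by positivity)]
    have : ((n:ℝ) - 6) / 12 * (6 / a) = 1 := by
      rw [haN]; field_simp; ring
    rw [this, Real.rpow_one]
    field_simp
  have hf := fpow_NL hC0 hα he heK
  have hd : ∀ m : ℕ, m < 6 → ∀ t, HasDerivAt (iteratedDeriv m v) (iteratedDeriv (m+1) v t) t := by
    intro m hm t
    rw [iteratedDeriv_succ]
    have h1 : Differentiable ℝ (iteratedDeriv m v) :=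
      hv.differentiable_iteratedDeriv m (by exact_mod_cast hm)
    exact (h1 t).hasDerivAt
  have h0 := hd 0 (by norm_num)
  rw [iteratedDeriv_zero] at h0
  obtain ⟨p, u, q, z, r, S⟩ := toSol (a := a) (b := a + 2) (c := a + 4) h0 (hd 1 (by norm_num))
    (hd 2 (by norm_num)) (hd 3 (by norm_num)) (hd 4 (by norm_num)) (hd 5 (by norm_num)) hM hf
    hK4 hK2 hK0 (by
      intro t
      have := hsol t
      rw [hexp] at this
      exact this)
  rw [hexp2]
  rcases S.classify hf ha (by linarith) (by linarith) hK0 with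
    ⟨x, hx, hxt⟩ | hper | ⟨hpos, hl⟩ | ⟨hneg, hl⟩
  · rcases hx with rfl | rfl | rfl
    · exact Or.inl hxt
    · exact Or.inr (Or.inl hxt)
    · exact Or.inr (Or.inr (Or.inl hxt))
  · exact Or.inr (Or.inr (Or.inr (Or.inr hper)))
  · obtain ⟨τ, hτ⟩ := homo_explicit ha hC hf S hpos hl
    exact Or.inr (Or.inr (Or.inr (Or.inl ⟨τ, Or.inl hτ⟩)))
  · obtain ⟨τ, hτ⟩ := homo_explicit ha hC hf (S.neg hf) (fun t => by linarith [hneg t])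
      (by simpa using hl.neg)
    refine Or.inr (Or.inr (Or.inr (Or.inl ⟨τ, Or.inr fun t => ?_⟩)))
    linarith [hτ t]
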